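/- arXiv:1805.05529 — 6 statements merged into one kernel-verified Lean document; each statement's English description precedes it below -/
import Mathlib

section
/- Let N be a positive integer and let ν_1, …, ν_N > 0. Let X be a random N×N real matrix whose rows are independent, with row l distributed according to the beta type I density π^{-N/2} (Γ((ν_l+N)/2)/Γ(ν_l/2)) (1−|x|²)^{ν_l/2−1} supported on the open unit ball of ℝ^N. Then E[log|det X|] is finite and equals (1/2) Σ_{l=1}^N ( Ψ((N−l+1)/2) − Ψ((N+ν_l)/2) ), where Ψ(x) = (d/dx) log Γ(x) is the digamma function. -/
open MeasureTheory Real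

/-- The digamma function `Ψ(x) = (d/dx) log Γ(x)`. -/
noncomputable def digamma (x : ℝ) : ℝ := deriv (fun y => Real.log (Real.Gamma y)) x

/-- The distribution on `ℝ^N` of a row with beta type I density
`π^{-N/2} (Γ((ν+N)/2)/Γ(ν/2)) (1-|x|²)^{ν/2-1}` supported on the open unit ball. -/
noncomputable def betaIRowMeasure (N : ℕ) (ν : ℝ) : Measure (Fin N → ℝ) :=
  volume.withDensity fun x =>
    ENNReal.ofReal (if ∑ j, x j ^ 2 < 1 then
      π ^ (-(N : ℝ) / 2) * (Real.Gamma ((ν + N) / 2) / Real.Gamma (ν / 2)) *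
        (1 - ∑ j, x j ^ 2) ^ (ν / 2 - 1)
    else 0)

open scoped ENNReal

/-- Polar coordinates for the Lebesgue integral of a radial function. -/
lemma lintegral_fun_norm_addHaar {E : Type*} [NormedAddCommGroup E] [NormedSpace ℝ E]
    [MeasurableSpace E] [BorelSpace E] [FiniteDimensional ℝ E] [Nontrivial E] (μ : Measure E)
    [μ.IsAddHaarMeasure] {f : ℝ → ℝ≥0∞} (hf : Measurable f) :
    ∫⁻ x, f ‖x‖ ∂μ = Module.finrank ℝ E * μ (Metric.ball 0 1) *
      ∫⁻ y in Set.Ioi (0 : ℝ), ENNReal.ofReal (y ^ (Module.finrank ℝ E - 1)) * f y := by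
  calc
    ∫⁻ x, f ‖x‖ ∂μ = ∫⁻ x : ({(0)}ᶜ : Set E), f ‖x.1‖ ∂(μ.comap (↑)) := by
      rw [lintegral_subtype_comap (measurableSet_singleton _).compl fun x ↦ f ‖x‖,
        restrict_compl_singleton]
    _ = ∫⁻ x, f x.2 ∂μ.toSphere.prod (.volumeIoiPow (Module.finrank ℝ E - 1)) := by
      simpa using (μ.measurePreserving_homeomorphUnitSphereProd.lintegral_comp_emb
        (Homeomorph.measurableEmbedding _) (f ∘ Subtype.val ∘ Prod.snd))
    _ = μ.toSphere Set.univ *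
        ∫⁻ x : Set.Ioi (0 : ℝ), f x ∂.volumeIoiPow (Module.finrank ℝ E - 1) := by
      rw [lintegral_prod _ (by fun_prop)]
      simp [mul_comm]
    _ = _ := by
      rw [Measure.toSphere_apply_univ, Measure.volumeIoiPow,
        lintegral_withDensity_eq_lintegral_mul _ (by fun_prop) (by fun_prop),
        ← lintegral_subtype_comap measurableSet_Ioi]
      rfl

/-- The Euler beta integral in the radial variable `r = √(s u)`. -/
lemma lintegral_radial_beta {s a b : ℝ} (hs : 0 < s) (ha : 0 < a) (hb : 0 < b) :
    ∫⁻ r in Set.Ioi (0 : ℝ), ENNReal.ofReal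
        (if r ^ 2 < s then r ^ (2 * a - 1) * (s - r ^ 2) ^ (b - 1) else 0) =
      ENNReal.ofReal (s ^ (a + b - 1) * ProbabilityTheory.beta a b / 2) := by
  have himg : (fun u : ℝ => √(s * u)) '' Set.Ioo 0 1 = Set.Ioo 0 √s := by
    ext r
    constructor
    · rintro ⟨u, ⟨hu0, hu1⟩, rfl⟩
      exact ⟨by positivity, Real.sqrt_lt_sqrt (by positivity) (by nlinarith)⟩
    · rintro ⟨h0, h1⟩
      have h2 : r ^ 2 < s := (Real.lt_sqrt h0.le).1 h1
      refine ⟨r ^ 2 / s, ⟨by positivity, (div_lt_one hs).2 h2⟩, ?_⟩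
      simp only
      rw [mul_div_cancel₀ _ hs.ne', Real.sqrt_sq h0.le]
  have hinj : Set.InjOn (fun u : ℝ => √(s * u)) (Set.Ioo 0 1) := by
    intro u hu v hv h
    have := (Real.sqrt_inj (mul_pos hs hu.1).le (mul_pos hs hv.1).le).1 h
    exact mul_left_cancel₀ hs.ne' this
  have hder : ∀ u ∈ Set.Ioo (0 : ℝ) 1,
      HasDerivWithinAt (fun u : ℝ => √(s * u)) (s / (2 * √(s * u))) (Set.Ioo 0 1) u := by
    intro u hu
    have h1 : HasDerivAt (fun u : ℝ => s * u) s u := by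
      simpa using (hasDerivAt_id u).const_mul s
    exact (h1.sqrt (mul_pos hs hu.1).ne').hasDerivWithinAt
  have hcov := lintegral_image_eq_lintegral_abs_deriv_mul measurableSet_Ioo hder hinj
    (fun r => ENNReal.ofReal (r ^ (2 * a - 1) * (s - r ^ 2) ^ (b - 1)))
  rw [himg] at hcov
  have hleft : ∫⁻ r in Set.Ioi (0 : ℝ), ENNReal.ofReal
        (if r ^ 2 < s then r ^ (2 * a - 1) * (s - r ^ 2) ^ (b - 1) else 0) =
      ∫⁻ r in Set.Ioo (0 : ℝ) √s, ENNReal.ofReal (r ^ (2 * a - 1) * (s - r ^ 2) ^ (b - 1)) := by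
    rw [← lintegral_indicator measurableSet_Ioi, ← lintegral_indicator measurableSet_Ioo]
    congr 1
    ext r
    by_cases h0 : 0 < r
    · have := Real.lt_sqrt (y := s) h0.le
      by_cases h1 : r ^ 2 < s <;> simp [Set.indicator, h0, h1, this]
    · simp [Set.indicator, h0]
  have hone := ProbabilityTheory.lintegral_betaPDF_eq_one ha hb
  rw [ProbabilityTheory.lintegral_betaPDF] at hone
  have hB := ProbabilityTheory.beta_pos ha hb
  have hc : 0 ≤ s ^ (a + b - 1) * ProbabilityTheory.beta a b / 2 := by positivity
  rw [hleft, hcov, ← mul_one (ENNReal.ofReal (s ^ (a + b - 1) * _ / 2)), ← hone,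
    ← lintegral_const_mul' _ _ ENNReal.ofReal_ne_top]
  refine setLIntegral_congr_fun measurableSet_Ioo fun u hu => ?_
  have hu0 := hu.1
  have hsu : 0 < s * u := mul_pos hs hu0
  rw [← ENNReal.ofReal_mul (abs_nonneg _), ← ENNReal.ofReal_mul hc]
  congr 1
  have e1 : √(s * u) ^ (2 * a - 1) = (s * u) ^ (a - 1) * √(s * u) := by
    rw [Real.sqrt_eq_rpow, ← Real.rpow_mul hsu.le, ← Real.rpow_add hsu]
    congr 1; ring
  have e2 : s - √(s * u) ^ 2 = s * (1 - u) := by rw [Real.sq_sqrt hsu.le]; ring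
  have e3 : s ^ (a + b - 1) = s ^ (a - 1) * s ^ (b - 1) * s := by
    rw [← Real.rpow_add hs, ← Real.rpow_add_one hs.ne']
    congr 1; ring
  have hq : 0 < √(s * u) := Real.sqrt_pos.2 hsu
  rw [e1, e2, e3, abs_of_pos (by positivity), Real.mul_rpow hs.le hu0.le,
    Real.mul_rpow hs.le (by linarith [hu.2])]
  field_simp

lemma measurable_betaIRow_density (N : ℕ) (c b : ℝ) :
    Measurable fun x : Fin N → ℝ => ENNReal.ofReal (if ∑ j, x j ^ 2 < 1 then
      c * (1 - ∑ j, x j ^ 2) ^ b else 0) :=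
  (Measurable.ite (measurableSet_lt (by fun_prop) measurable_const) (by fun_prop)
    measurable_const).ennreal_ofReal

lemma lintegral_betaIRowMeasure (N : ℕ) (ν : ℝ) {f : (Fin N → ℝ) → ℝ≥0∞} (hf : Measurable f) :
    ∫⁻ x, f x ∂betaIRowMeasure N ν = ∫⁻ x : Fin N → ℝ,
      ENNReal.ofReal (if ∑ j, x j ^ 2 < 1 then
        π ^ (-(N : ℝ) / 2) * (Real.Gamma ((ν + N) / 2) / Real.Gamma (ν / 2)) *
          (1 - ∑ j, x j ^ 2) ^ (ν / 2 - 1) else 0) * f x := by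
  rw [betaIRowMeasure,
    lintegral_withDensity_eq_lintegral_mul _ (measurable_betaIRow_density N _ _) hf]
  rfl

instance (N : ℕ) (ν : ℝ) : SigmaFinite (betaIRowMeasure N ν) :=
  SigmaFinite.withDensity_ofReal _

/-- The moments of the Euclidean norm of a beta type I row. -/
lemma lintegral_norm_rpow_betaIRowMeasure (n : ℕ) {ν t : ℝ} (hν : 0 < ν)
    (ht : -((n : ℝ) + 1) < t) :
    ∫⁻ x, ENNReal.ofReal √(∑ j, x j ^ 2) ^ t ∂betaIRowMeasure (n + 1) ν =
      ENNReal.ofReal (Real.Gamma (((n : ℝ) + 1 + t) / 2) * Real.Gamma (((n : ℝ) + 1 + ν) / 2) /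
        (Real.Gamma (((n : ℝ) + 1) / 2) * Real.Gamma (((n : ℝ) + 1 + ν + t) / 2))) := by
  rw [lintegral_betaIRowMeasure _ _ (by fun_prop)]
  set c : ℝ := π ^ (-((n + 1 : ℕ) : ℝ) / 2) *
    (Real.Gamma ((ν + (n + 1 : ℕ)) / 2) / Real.Gamma (ν / 2)) with hc
  have hc0 : 0 < c := by
    have h1 := Real.Gamma_pos_of_pos (half_pos hν)
    have h2 : 0 < Real.Gamma ((ν + (n + 1 : ℕ)) / 2) := Real.Gamma_pos_of_pos (by positivity)
    positivity
  let f : ℝ → ℝ≥0∞ := fun r =>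
    ENNReal.ofReal (if r ^ 2 < 1 then c * (1 - r ^ 2) ^ (ν / 2 - 1) else 0) * ENNReal.ofReal r ^ t
  have hf : Measurable f :=
    (Measurable.ite (measurableSet_lt (by fun_prop) measurable_const) (by fun_prop)
      measurable_const).ennreal_ofReal.mul (by fun_prop)
  have hpolar := lintegral_fun_norm_addHaar
    (volume : Measure (EuclideanSpace ℝ (Fin (n + 1)))) hf
  rw [← (PiLp.volume_preserving_toLp (Fin (n + 1))).lintegral_comp (by fun_prop)] at hpolar
  have hleft : (∫⁻ x : Fin (n + 1) → ℝ, ENNReal.ofReal (if ∑ j, x j ^ 2 < 1 then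
      c * (1 - ∑ j, x j ^ 2) ^ (ν / 2 - 1) else 0) * ENNReal.ofReal √(∑ j, x j ^ 2) ^ t) =
      ∫⁻ x : Fin (n + 1) → ℝ, f ‖(WithLp.toLp 2 x : EuclideanSpace ℝ (Fin (n + 1)))‖ := by
    refine lintegral_congr fun x => ?_
    have hx : 0 ≤ ∑ j, x j ^ 2 := by positivity
    simp only [f, EuclideanSpace.norm_eq, Real.norm_eq_abs, sq_abs, Real.sq_sqrt hx]
  have hradial : (∫⁻ y in Set.Ioi (0 : ℝ), ENNReal.ofReal (y ^ n) * f y) =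
      ENNReal.ofReal c * ENNReal.ofReal
        (ProbabilityTheory.beta (((n : ℝ) + 1 + t) / 2) (ν / 2) / 2) := by
    have hb := lintegral_radial_beta one_pos
      (show 0 < ((n : ℝ) + 1 + t) / 2 by linarith) (half_pos hν)
    rw [Real.one_rpow, one_mul] at hb
    rw [← hb, ← lintegral_const_mul' _ _ ENNReal.ofReal_ne_top]
    refine setLIntegral_congr_fun measurableSet_Ioi fun y hy => ?_
    have hy : 0 < y := hy
    by_cases h1 : y ^ 2 < 1
    · have hp : 0 < 1 - y ^ 2 := by linarith
      simp only [f, h1, if_true]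
      rw [ENNReal.ofReal_rpow_of_pos hy, ← ENNReal.ofReal_mul (by positivity),
        ← ENNReal.ofReal_mul (by positivity), ← ENNReal.ofReal_mul (by positivity)]
      congr 1
      rw [show 2 * (((n : ℝ) + 1 + t) / 2) - 1 = n + t by ring, Real.rpow_add hy,
        Real.rpow_natCast]
      ring
    · simp only [f, if_neg h1, ENNReal.ofReal_zero, zero_mul, mul_zero]
  rw [hleft, hpolar, EuclideanSpace.volume_ball]
  simp only [finrank_euclideanSpace, Fintype.card_fin, Nat.add_sub_cancel, ENNReal.ofReal_one,
    one_pow, one_mul]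
  rw [hradial, ← ENNReal.ofReal_natCast, ← ENNReal.ofReal_mul (by positivity),
    ← ENNReal.ofReal_mul (by positivity), ← ENNReal.ofReal_mul]
  swap
  · have : 0 < Real.Gamma (((n + 1 : ℕ) : ℝ) / 2 + 1) := Real.Gamma_pos_of_pos (by positivity)
    positivity
  congr 1
  have hπ : √π ^ (n + 1) * π ^ (-((n + 1 : ℕ) : ℝ) / 2) = 1 := by
    rw [Real.sqrt_eq_rpow, ← Real.rpow_natCast, ← Real.rpow_mul pi_pos.le,
      ← Real.rpow_add pi_pos,
      show 1 / 2 * ((n + 1 : ℕ) : ℝ) + -((n + 1 : ℕ) : ℝ) / 2 = 0 by ring, Real.rpow_zero]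
  have hn : ((n : ℝ) + 1) / 2 ≠ 0 := by positivity
  have g1 : Real.Gamma (((n : ℝ) + 1) / 2) ≠ 0 := (Real.Gamma_pos_of_pos (by positivity)).ne'
  have g2 : Real.Gamma (((n : ℝ) + 1 + ν + t) / 2) ≠ 0 :=
    (Real.Gamma_pos_of_pos (by linarith)).ne'
  have g3 := (Real.Gamma_pos_of_pos (half_pos hν)).ne'
  have e1 : ((n : ℝ) + 1 + t) / 2 + ν / 2 = ((n : ℝ) + 1 + ν + t) / 2 := by ring
  have e2 : (ν + ((n : ℝ) + 1)) / 2 = ((n : ℝ) + 1 + ν) / 2 := by ring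
  rw [hc, ProbabilityTheory.beta, e1]
  push_cast at hπ ⊢
  rw [Real.Gamma_add_one hn, e2]
  calc _ = (√π ^ (n + 1) * π ^ (-((n : ℝ) + 1) / 2)) *
        (Real.Gamma (((n : ℝ) + 1 + t) / 2) * Real.Gamma (((n : ℝ) + 1 + ν) / 2) /
        (Real.Gamma (((n : ℝ) + 1) / 2) * Real.Gamma (((n : ℝ) + 1 + ν + t) / 2))) := by
        field_simp
    _ = _ := by rw [neg_add] at hπ ⊢; rw [hπ, one_mul]

/-- Beta type I rows are invariant under orthogonal transformations. -/
lemma measurePreserving_mulVec_betaIRowMeasure (N : ℕ) (ν : ℝ) {O : Matrix (Fin N) (Fin N) ℝ}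
    (hO : O.transpose * O = 1) :
    MeasurePreserving (fun x => O.mulVec x) (betaIRowMeasure N ν) (betaIRowMeasure N ν) := by
  have hmeas : Measurable fun x : Fin N → ℝ => O.mulVec x := by
    have := (Matrix.toLin' O).continuous_of_finiteDimensional.measurable
    simpa using! this
  have hdet : O.det * O.det = 1 := by
    simpa using congrArg Matrix.det hO
  have hdet0 : O.det ≠ 0 := fun h => by simp [h] at hdet
  have habs : |O.det⁻¹| = 1 := by
    rw [abs_inv, inv_eq_one]
    exact (abs_eq zero_le_one).2 (mul_self_eq_one_iff.1 hdet)
  have hvol : MeasurePreserving (fun x : Fin N → ℝ => O.mulVec x) := by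
    refine ⟨hmeas, ?_⟩
    have := Real.map_matrix_volume_pi_eq_smul_volume_pi hdet0
    rw [habs, ENNReal.ofReal_one, one_smul] at this
    exact this
  have hsq (x : Fin N → ℝ) : ∑ j, (O.mulVec x) j ^ 2 = ∑ j, x j ^ 2 := by
    have : O.mulVec x ⬝ᵥ O.mulVec x = x ⬝ᵥ x := by
      rw [Matrix.dotProduct_mulVec, Matrix.vecMul_mulVec, hO, Matrix.vecMul_one]
    simpa [dotProduct, sq] using this
  refine ⟨hmeas, Measure.ext_of_lintegral _ fun f hf => ?_⟩
  rw [lintegral_map hf hmeas, lintegral_betaIRowMeasure _ _ (f := fun x => f (O.mulVec x)) (hf.comp hmeas),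
    lintegral_betaIRowMeasure _ _ hf]
  refine Eq.trans (lintegral_congr fun x => ?_)
    (hvol.lintegral_comp ((measurable_betaIRow_density N _ _).mul hf))
  simp only [hsq]

/-- Dropping one coordinate of a beta type I row increases the parameter by one. -/
lemma measurePreserving_tail_betaIRowMeasure (n : ℕ) {ν : ℝ} (hν : 0 < ν) :
    MeasurePreserving (fun (x : Fin (n + 1) → ℝ) (j : Fin n) => x j.succ)
      (betaIRowMeasure (n + 1) ν) (betaIRowMeasure n (ν + 1)) := by
  have hmeas : Measurable fun (x : Fin (n + 1) → ℝ) (j : Fin n) => x j.succ := by fun_prop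
  refine ⟨hmeas, Measure.ext_of_lintegral _ fun f hf => ?_⟩
  rw [lintegral_map hf hmeas, lintegral_betaIRowMeasure _ _ (f := fun x => f fun j => x j.succ) (hf.comp hmeas),
    lintegral_betaIRowMeasure _ _ hf]
  refine ((volume_preserving_piFinSuccAbove (fun _ : Fin (n + 1) => ℝ) 0).symm.lintegral_comp
    ((measurable_betaIRow_density _ _ _).mul (hf.comp hmeas))).symm.trans ?_
  rw [Measure.volume_eq_prod, lintegral_prod_symm _ (by
      exact (((measurable_betaIRow_density _ _ _).mul (hf.comp hmeas)).comp
        (MeasurableEquiv.measurable _)).aemeasurable)]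
  refine lintegral_congr fun y => ?_
  set c : ℝ := π ^ (-((n + 1 : ℕ) : ℝ) / 2) *
    (Real.Gamma ((ν + (n + 1 : ℕ)) / 2) / Real.Gamma (ν / 2)) with hc
  have hg1 := Real.Gamma_pos_of_pos (half_pos hν)
  have hg2 : 0 < Real.Gamma ((ν + 1) / 2) := Real.Gamma_pos_of_pos (by positivity)
  have hc0 : 0 < c := by
    have h2 : 0 < Real.Gamma ((ν + (n + 1 : ℕ)) / 2) := Real.Gamma_pos_of_pos (by positivity)
    positivity
  let g : ℝ → ℝ≥0∞ := fun r => ENNReal.ofReal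
    (if r ^ 2 < 1 - ∑ j, y j ^ 2 then (1 - ∑ j, y j ^ 2 - r ^ 2) ^ (ν / 2 - 1) else 0)
  have hg : Measurable g :=
    (Measurable.ite (measurableSet_lt (by fun_prop) measurable_const) (by fun_prop)
      measurable_const).ennreal_ofReal
  have hsplit (r : ℝ) : (ENNReal.ofReal (if r ^ 2 + ∑ j, y j ^ 2 < 1 then
      c * (1 - (r ^ 2 + ∑ j, y j ^ 2)) ^ (ν / 2 - 1) else 0) * f y) =
      ENNReal.ofReal c * f y * g r := by
    have hiff : r ^ 2 + ∑ j, y j ^ 2 < 1 ↔ r ^ 2 < 1 - ∑ j, y j ^ 2 := by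
      constructor <;> intro h <;> linarith
    simp only [g, hiff]
    rw [show 1 - (r ^ 2 + ∑ j, y j ^ 2) = 1 - ∑ j, y j ^ 2 - r ^ 2 by ring,
      mul_right_comm (ENNReal.ofReal c), ← ENNReal.ofReal_mul hc0.le, mul_ite, mul_zero]
  have hint : ∫⁻ r, g r = ENNReal.ofReal (if ∑ j, y j ^ 2 < 1 then
      (1 - ∑ j, y j ^ 2) ^ ((ν + 1) / 2 - 1) * ProbabilityTheory.beta (1 / 2) (ν / 2) else 0) := by
    by_cases hs : ∑ j, y j ^ 2 < 1
    · have hb := lintegral_radial_beta (sub_pos.2 hs) one_half_pos (half_pos hν)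
      have heven : ∫⁻ r in Set.Iio (0 : ℝ), g r = ∫⁻ r in Set.Ioi (0 : ℝ), g r := by
        have hneg := (Measure.measurePreserving_neg (volume : Measure ℝ)).setLIntegral_comp_preimage
          (measurableSet_Iio (a := (0 : ℝ))) hg
        rw [← hneg]
        simp [g]
      rw [← lintegral_add_compl _ (measurableSet_Ioi (a := (0 : ℝ))), Set.compl_Ioi,
        setLIntegral_congr Iio_ae_eq_Iic.symm, heven]
      have : ∫⁻ r in Set.Ioi (0 : ℝ), g r = ENNReal.ofReal ((1 - ∑ j, y j ^ 2) ^
          (1 / 2 + ν / 2 - 1) * ProbabilityTheory.beta (1 / 2) (ν / 2) / 2) := by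
        rw [← hb]
        simp [g]
      have hbeta := ProbabilityTheory.beta_pos one_half_pos (half_pos hν)
      have hs' := sub_pos.2 hs
      rw [this, ← ENNReal.ofReal_add (by positivity) (by positivity), if_pos hs, add_halves,
        show 1 / 2 + ν / 2 - 1 = (ν + 1) / 2 - 1 by ring]
    · have : g = 0 := by
        ext r
        have : ¬ r ^ 2 < 1 - ∑ j, y j ^ 2 := by nlinarith [sq_nonneg r]
        simp [g, this]
      simp [this, hs]
  have hconst : c * ProbabilityTheory.beta (1 / 2) (ν / 2) =
      π ^ (-(n : ℝ) / 2) * (Real.Gamma ((ν + 1 + n) / 2) / Real.Gamma ((ν + 1) / 2)) := by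
    have hπ : π ^ (-((n + 1 : ℕ) : ℝ) / 2) * √π = π ^ (-(n : ℝ) / 2) := by
      rw [Real.sqrt_eq_rpow, ← Real.rpow_add pi_pos]
      congr 1; push_cast; ring
    rw [hc, ProbabilityTheory.beta, Real.Gamma_one_half_eq, ← hπ,
      show (1 : ℝ) / 2 + ν / 2 = (ν + 1) / 2 by ring,
      show (ν + (n + 1 : ℕ)) / 2 = (ν + 1 + n) / 2 by push_cast; ring]
    field_simp
  have hstep : (∫⁻ r, ENNReal.ofReal (if r ^ 2 + ∑ j, y j ^ 2 < 1 then
      c * (1 - (r ^ 2 + ∑ j, y j ^ 2)) ^ (ν / 2 - 1) else 0) * f y) =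
      ENNReal.ofReal (if ∑ j, y j ^ 2 < 1 then
        π ^ (-(n : ℝ) / 2) * (Real.Gamma ((ν + 1 + n) / 2) / Real.Gamma ((ν + 1) / 2)) *
          (1 - ∑ j, y j ^ 2) ^ ((ν + 1) / 2 - 1) else 0) * f y := by
    simp_rw [hsplit]
    rw [lintegral_const_mul _ hg, hint, mul_right_comm (ENNReal.ofReal c),
      ← ENNReal.ofReal_mul hc0.le, mul_ite, mul_zero, ← hconst, mul_left_comm c,
      mul_comm (_ ^ _) (c * _)]
  rw [← hstep]
  refine lintegral_congr fun r => ?_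
  simp [Fin.sum_univ_succ, c, Function.comp_def]

/-- Every vector is carried by some orthogonal matrix to a multiple of the first basis vector. -/
lemma exists_orthogonal_mulVec_eq_single (n : ℕ) (x : Fin (n + 1) → ℝ) :
    ∃ O : Matrix (Fin (n + 1)) (Fin (n + 1)) ℝ, O.transpose * O = 1 ∧
      O.mulVec x = Pi.single 0 √(∑ j, x j ^ 2) := by
  by_cases hx : x = 0
  · exact ⟨1, by simp, by simp [hx]⟩
  let X : EuclideanSpace ℝ (Fin (n + 1)) := WithLp.toLp 2 x
  have hX : ‖X‖ = √(∑ j, x j ^ 2) := by simp [X, EuclideanSpace.norm_eq]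
  have hX0 : ‖X‖ ≠ 0 := by simpa [X] using hx
  have horth : Orthonormal ℝ (({0} : Set (Fin (n + 1))).domRestrict
      fun _ : Fin (n + 1) => ‖X‖⁻¹ • X) := by
    refine ⟨fun i => ?_, fun i j hij => (hij (Subsingleton.elim i j)).elim⟩
    simp [norm_smul, hX0]
  obtain ⟨b, hb⟩ := horth.exists_orthonormalBasis_extension_of_card_eq (by simp)
  have hb0 : X = ‖X‖ • b 0 := by rw [hb 0 rfl, smul_smul, mul_inv_cancel₀ hX0, one_smul]
  refine ⟨Matrix.of fun i j => b i j, ?_, ?_⟩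
  · rw [mul_eq_one_comm]
    ext i j
    have := orthonormal_iff_ite.1 b.orthonormal j i
    simpa [Matrix.mul_apply, PiLp.inner_apply, Matrix.one_apply, eq_comm] using this
  · ext i
    have h : inner ℝ X (b i) = ‖X‖ * inner ℝ (b 0) (b i) := by
      conv_lhs => rw [hb0]
      rw [real_inner_smul_left]
    rw [orthonormal_iff_ite.1 b.orthonormal 0 i] at h
    rw [Pi.single_apply, ← hX]
    simpa [Matrix.mulVec, dotProduct, PiLp.inner_apply, X, eq_comm] using h

lemma abs_det_cons_eq_norm_mul {n : ℕ} {O : Matrix (Fin (n + 1)) (Fin (n + 1)) ℝ}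
    (hO : O.transpose * O = 1) {x : Fin (n + 1) → ℝ} {r : ℝ} (hr : 0 ≤ r)
    (hx : O.mulVec x = Pi.single 0 r) (M : Fin n → Fin (n + 1) → ℝ) :
    |(Matrix.of (Fin.cons x M : Fin (n + 1) → Fin (n + 1) → ℝ)).det| =
      r * |(Matrix.of fun i j => O.mulVec (M i) j.succ).det| := by
  set A := Matrix.of (Fin.cons x M : Fin (n + 1) → Fin (n + 1) → ℝ) with hA
  have hdet : O.det * O.det = 1 := by simpa using congrArg Matrix.det hO
  have habs : |O.det| = 1 := (abs_eq zero_le_one).2 (mul_self_eq_one_iff.1 hdet)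
  have hentry (i j) : (A * O.transpose) i j = O.mulVec (A i) j := by
    simp [Matrix.mul_apply, Matrix.mulVec, dotProduct, mul_comm]
  have hmul : (A * O.transpose).det =
      r * (Matrix.of fun i j => O.mulVec (M i) j.succ).det := by
    have hrow (j) : (A * O.transpose) 0 j = (Pi.single 0 r : Fin (n + 1) → ℝ) j := by
      rw [hentry, ← hx]
      rfl
    rw [Matrix.det_succ_row_zero, Finset.sum_eq_single 0]
    · rw [hrow]
      have : (A * O.transpose).submatrix Fin.succ (Fin.succAbove 0) =
          Matrix.of fun i j => O.mulVec (M i) j.succ := by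
        ext i j
        rw [Matrix.submatrix_apply, hentry]
        rfl
      rw [this]
      simp
    · intro j _ hj
      rw [hrow]
      simp [hj]
    · simp
  calc |A.det| = |(A * O.transpose).det| := by
        rw [Matrix.det_mul, abs_mul, Matrix.det_transpose, habs, mul_one]
    _ = _ := by rw [hmul, abs_mul, abs_of_nonneg hr]

lemma measurable_det_of (N : ℕ) :
    Measurable fun M : Fin N → Fin N → ℝ => (Matrix.of M).det := by
  simp only [Matrix.det_apply, Matrix.of_apply]
  fun_prop

/-- The absolute moments of the determinant of a matrix with independent beta type I rows. -/
lemma lintegral_abs_det_rpow (N : ℕ) (ν : Fin N → ℝ) (hν : ∀ l, 0 < ν l) {t : ℝ} (ht : -1 < t) :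
    ∫⁻ M : Fin N → Fin N → ℝ, ENNReal.ofReal |(Matrix.of M).det| ^ t
        ∂(Measure.pi fun l => betaIRowMeasure N (ν l)) =
      ENNReal.ofReal (∏ l : Fin N,
        (Real.Gamma (((N : ℝ) - (l : ℕ) + t) / 2) * Real.Gamma (((N : ℝ) + ν l) / 2) /
          (Real.Gamma (((N : ℝ) - (l : ℕ)) / 2) * Real.Gamma (((N : ℝ) + ν l + t) / 2)))) := by
  induction N with
  | zero => simp
  | succ n ih =>
    have hmeas : Measurable fun M : Fin (n + 1) → Fin (n + 1) → ℝ =>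
        ENNReal.ofReal |(Matrix.of M).det| ^ t :=
      ((measurable_det_of (n + 1)).abs.ennreal_ofReal).pow_const t
    have hih := ih (fun l => ν l.succ + 1) fun l => by linarith [hν l.succ]
    set L := ∏ l : Fin n, (Real.Gamma (((n : ℝ) - (l : ℕ) + t) / 2) *
      Real.Gamma (((n : ℝ) + (ν l.succ + 1)) / 2) / (Real.Gamma (((n : ℝ) - (l : ℕ)) / 2) *
        Real.Gamma (((n : ℝ) + (ν l.succ + 1) + t) / 2))) with hL
    have hinner (x : Fin (n + 1) → ℝ) :
        ∫⁻ M : Fin n → Fin (n + 1) → ℝ,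
          ENNReal.ofReal |(Matrix.of (Fin.cons x M : Fin (n + 1) → Fin (n + 1) → ℝ)).det| ^ t
            ∂(Measure.pi fun l => betaIRowMeasure (n + 1) (ν l.succ)) =
        ENNReal.ofReal √(∑ j, x j ^ 2) ^ t * ENNReal.ofReal L := by
      obtain ⟨O, hO, hx⟩ := exists_orthogonal_mulVec_eq_single n x
      have hpres := measurePreserving_pi (fun l : Fin n => betaIRowMeasure (n + 1) (ν l.succ))
        (fun l : Fin n => betaIRowMeasure n (ν l.succ + 1)) fun l =>
        (measurePreserving_tail_betaIRowMeasure n (hν l.succ)).comp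
          (measurePreserving_mulVec_betaIRowMeasure (n + 1) (ν l.succ) hO)
      have hmeas' : Measurable fun M : Fin n → Fin n → ℝ =>
          ENNReal.ofReal |(Matrix.of M).det| ^ t :=
        ((measurable_det_of n).abs.ennreal_ofReal).pow_const t
      rw [← hih, ← hpres.lintegral_comp hmeas']
      refine Eq.trans (lintegral_congr fun M => ?_)
        (lintegral_const_mul _ (hmeas'.comp hpres.measurable))
      rw [abs_det_cons_eq_norm_mul hO (Real.sqrt_nonneg _) hx,
        ENNReal.ofReal_mul (Real.sqrt_nonneg _),
        ENNReal.mul_rpow_of_ne_top ENNReal.ofReal_ne_top ENNReal.ofReal_ne_top]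
      rfl
    have hsplit := ((measurePreserving_piFinSuccAbove
      (fun l : Fin (n + 1) => betaIRowMeasure (n + 1) (ν l)) 0).symm.lintegral_comp hmeas).symm.trans
      (lintegral_prod _ (hmeas.comp (MeasurableEquiv.measurable _)).aemeasurable)
    rw [hsplit]
    have hcons (x : Fin (n + 1) → ℝ) (M : Fin n → Fin (n + 1) → ℝ) :
        (MeasurableEquiv.piFinSuccAbove (fun _ : Fin (n + 1) => Fin (n + 1) → ℝ) 0).symm (x, M) =
          Fin.cons x M := by
      simp [MeasurableEquiv.piFinSuccAbove, Fin.consEquiv]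
    simp only [hcons, Fin.zero_succAbove, hinner]
    rw [lintegral_mul_const _ (by fun_prop),
      lintegral_norm_rpow_betaIRowMeasure n (hν 0) (by linarith [n.cast_nonneg (α := ℝ)]),
      ← ENNReal.ofReal_mul, Fin.prod_univ_succ, hL]
    · congr 2
      · simp
      · refine Finset.prod_congr rfl fun l _ => ?_
        simp only [Fin.val_succ]
        push_cast
        congr 3 <;> ring_nf
    · have h0 := hν 0
      have hn := n.cast_nonneg (α := ℝ)
      have h1 : 0 < Real.Gamma (((n : ℝ) + 1 + t) / 2) := Real.Gamma_pos_of_pos (by linarith)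
      have h2 : 0 < Real.Gamma (((n : ℝ) + 1 + ν 0) / 2) := Real.Gamma_pos_of_pos (by linarith)
      have h3 : 0 < Real.Gamma (((n : ℝ) + 1) / 2) := Real.Gamma_pos_of_pos (by linarith)
      have h4 : 0 < Real.Gamma (((n : ℝ) + 1 + ν 0 + t) / 2) := Real.Gamma_pos_of_pos (by linarith)
      positivity

lemma hasDerivAt_log_Gamma {x : ℝ} (hx : 0 < x) :
    HasDerivAt (fun y => Real.log (Real.Gamma y)) (digamma x) x := by
  have hd : DifferentiableAt ℝ Real.Gamma x := Real.differentiableAt_Gamma fun m => by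
    have := m.cast_nonneg (α := ℝ)
    linarith
  exact (hd.log (Real.Gamma_pos_of_pos hx).ne').hasDerivAt

theorem statement10 (N : ℕ) (hN : 0 < N) (ν : Fin N → ℝ) (hν : ∀ l, 0 < ν l) :
    Integrable (fun M : Fin N → Fin N → ℝ => Real.log |Matrix.det (Matrix.of M)|)
      (Measure.pi fun l => betaIRowMeasure N (ν l)) ∧
    ∫ M : Fin N → Fin N → ℝ, Real.log |Matrix.det (Matrix.of M)|
        ∂(Measure.pi fun l => betaIRowMeasure N (ν l)) =
      (1 / 2) * ∑ l : Fin N,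
        (digamma (((N : ℝ) - (l : ℕ)) / 2) - digamma (((N : ℝ) + ν l) / 2)) := by
  set μ := Measure.pi fun l => betaIRowMeasure N (ν l) with hμ
  set X : (Fin N → Fin N → ℝ) → ℝ := fun M => Real.log |Matrix.det (Matrix.of M)| with hX
  let g : ℝ → ℝ := fun t => ∑ l : Fin N,
    (Real.log (Real.Gamma (((N : ℝ) - (l : ℕ) + t) / 2)) -
      Real.log (Real.Gamma (((N : ℝ) - (l : ℕ)) / 2)) -
      (Real.log (Real.Gamma (((N : ℝ) + ν l + t) / 2)) -
        Real.log (Real.Gamma (((N : ℝ) + ν l) / 2))))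
  have hl (l : Fin N) : 1 ≤ (N : ℝ) - (l : ℕ) := by
    have : (l : ℕ) + 1 ≤ N := l.2
    have : ((l : ℕ) : ℝ) + 1 ≤ N := by exact_mod_cast this
    linarith
  have hlν (l : Fin N) : 1 < (N : ℝ) + ν l := by
    have := hl l
    have := hν l
    have := (l : ℕ).cast_nonneg (α := ℝ)
    linarith
  have hmeasX : Measurable X := (measurable_det_of N).abs.log
  have hmoment {t : ℝ} (ht : -1 < t) :
      ∫⁻ M, ENNReal.ofReal |(Matrix.of M).det| ^ t ∂μ = ENNReal.ofReal (Real.exp (g t)) := by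
    rw [hμ, lintegral_abs_det_rpow N ν hν ht, Real.exp_sum]
    congr 1
    refine Finset.prod_congr rfl fun l _ => ?_
    have h1 := hl l
    have h2 := hlν l
    rw [Real.exp_sub, Real.exp_sub, Real.exp_sub,
      Real.exp_log (Real.Gamma_pos_of_pos (by linarith)),
      Real.exp_log (Real.Gamma_pos_of_pos (by linarith)),
      Real.exp_log (Real.Gamma_pos_of_pos (by linarith)),
      Real.exp_log (Real.Gamma_pos_of_pos (by linarith))]
    rw [div_div_div_eq]
  have hne : ∀ᵐ M ∂μ, (Matrix.of M).det ≠ 0 := by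
    have hfin := ae_lt_top (μ := μ)
      (((measurable_det_of N).abs.ennreal_ofReal).pow_const (-1 / 2 : ℝ))
      (by rw [hmoment (by norm_num)]; exact ENNReal.ofReal_ne_top)
    filter_upwards [hfin] with M hM h0
    rw [h0, abs_zero, ENNReal.ofReal_zero, ENNReal.zero_rpow_of_neg (by norm_num)] at hM
    exact lt_irrefl _ hM
  have hexp {t : ℝ} (ht : -1 < t) :
      ∫⁻ M, ENNReal.ofReal (Real.exp (t * X M)) ∂μ = ENNReal.ofReal (Real.exp (g t)) := by
    rw [← hmoment ht]
    refine lintegral_congr_ae ?_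
    filter_upwards [hne] with M hM
    have hpos := abs_pos.2 hM
    rw [ENNReal.ofReal_rpow_of_pos hpos, Real.rpow_def_of_pos hpos, mul_comm]
  have hint {t : ℝ} (ht : -1 < t) : Integrable (fun M => Real.exp (t * X M)) μ := by
    refine ⟨(by fun_prop : Measurable _).aestronglyMeasurable, ?_⟩
    rw [hasFiniteIntegral_iff_ofReal (.of_forall fun _ => (Real.exp_pos _).le), hexp ht]
    exact ENNReal.ofReal_lt_top
  have hmgf {t : ℝ} (ht : -1 < t) : ProbabilityTheory.mgf X μ t = Real.exp (g t) := by
    rw [ProbabilityTheory.mgf, integral_eq_lintegral_of_nonneg_ae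
      (.of_forall fun _ => (Real.exp_pos _).le) (hint ht).aestronglyMeasurable, hexp ht,
      ENNReal.toReal_ofReal (Real.exp_pos _).le]
  have hmem : (0 : ℝ) ∈ interior (ProbabilityTheory.integrableExpSet X μ) :=
    mem_interior.2 ⟨Set.Ioi (-1), fun t ht => hint ht, isOpen_Ioi, by simp⟩
  refine ⟨ProbabilityTheory.integrable_of_mem_interior_integrableExpSet hmem, ?_⟩
  have hd := ProbabilityTheory.hasDerivAt_mgf hmem
  simp only [zero_mul, Real.exp_zero, mul_one] at hd
  have haff {c : ℝ} (hc : 0 < c) :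
      HasDerivAt (fun t => Real.log (Real.Gamma ((c + t) / 2))) (digamma (c / 2) * (1 / 2)) 0 := by
    have h1 : HasDerivAt (fun t : ℝ => (c + t) / 2) (1 / 2) 0 :=
      ((hasDerivAt_id (0 : ℝ)).const_add c).div_const 2
    have h2 : HasDerivAt (fun y => Real.log (Real.Gamma y)) (digamma (c / 2)) ((c + 0) / 2) := by
      rw [add_zero]
      exact hasDerivAt_log_Gamma (half_pos hc)
    exact h2.comp 0 h1
  have hg : HasDerivAt g (∑ l : Fin N, (digamma (((N : ℝ) - (l : ℕ)) / 2) * (1 / 2) -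
      digamma (((N : ℝ) + ν l) / 2) * (1 / 2))) 0 :=
    HasDerivAt.fun_sum fun l _ =>
      ((haff (by linarith [hl l])).sub_const _).sub ((haff (by linarith [hlν l])).sub_const _)
  have hg0 : g 0 = 0 := by simp [g]
  have hd' := hg.exp.congr_of_eventuallyEq
    (Filter.eventually_of_mem (Ioi_mem_nhds (by norm_num : (-1 : ℝ) < 0)) fun t ht => hmgf ht)
  rw [hd.unique hd', hg0, Real.exp_zero, one_mul, Finset.mul_sum]
  exact Finset.sum_congr rfl fun l _ => by ring
end

section
/- Let N be a positive integer and let ω_1, …, ω_N > 0. Let X be a random N×N real matrix whose rows are independent, with row l distributed according to the beta type II density π^{-N/2} (Γ((ω_l+N)/2)/Γ(ω_l/2)) (1+|x|²)^{-(N+ω_l)/2} on ℝ^N. Then E[log|det X|] is finite and equals (1/2) Σ_{l=1}^N ( Ψ((N−l+1)/2) − Ψ(ω_l/2) ), where Ψ(x) = (d/dx) log Γ(x) is the digamma function. -/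
open MeasureTheory Real

/-- The distribution on `ℝ^N` of a row with beta type II density
`π^{-N/2} (Γ((ω+N)/2)/Γ(ω/2)) (1+|x|²)^{-(N+ω)/2}` on `ℝ^N`. -/
noncomputable def betaIIRowMeasure (N : ℕ) (ω : ℝ) : Measure (Fin N → ℝ) :=
  volume.withDensity fun x =>
    ENNReal.ofReal (π ^ (-(N : ℝ) / 2) * (Real.Gamma ((ω + N) / 2) / Real.Gamma (ω / 2)) *
      (1 + ∑ j, x j ^ 2) ^ (-((N : ℝ) + ω) / 2))

/-- A nonnegative function with nonzero Bochner integral has Lebesgue integral of the same value. -/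
lemma lintegral_ofReal_of_integral_pos {α : Type*} [MeasurableSpace α] {μ : Measure α} {f : α → ℝ}
    {c : ℝ} (hf : 0 ≤ᵐ[μ] f) (h : ∫ x, f x ∂μ = c) (hc : 0 < c) :
    ∫⁻ x, ENNReal.ofReal (f x) ∂μ = ENNReal.ofReal c := by
  rw [← h, ofReal_integral_eq_lintegral_ofReal (.of_integral_ne_zero (h ▸ hc.ne')) hf]

lemma lintegral_rpow_mul_exp_neg_mul {a b : ℝ} (ha : 0 < a) (hb : 0 < b) :
    ∫⁻ t in Set.Ioi (0 : ℝ), ENNReal.ofReal (t ^ (a - 1) * rexp (-(b * t))) =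
      ENNReal.ofReal (b ^ (-a) * Gamma a) := by
  have := Gamma_pos_of_pos ha
  refine lintegral_ofReal_of_integral_pos ?_ ?_ (by positivity)
  · filter_upwards [ae_restrict_mem measurableSet_Ioi] with t (ht : 0 < t)
    simp only [Pi.zero_apply]
    positivity
  · rw [integral_rpow_mul_exp_neg_mul_Ioi ha hb, one_div, inv_rpow hb.le, rpow_neg hb.le]

lemma lintegral_rpow_mul_exp_neg_mul_sq {p t : ℝ} (hp : 0 < p) (ht : 0 < t) :
    ∫⁻ r in Set.Ioi (0 : ℝ), ENNReal.ofReal (r ^ (p - 1) * rexp (-(t * r ^ 2))) =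
      ENNReal.ofReal (t ^ (-(p / 2)) * (Gamma (p / 2) / 2)) := by
  have := Gamma_pos_of_pos (half_pos hp)
  refine lintegral_ofReal_of_integral_pos ?_ ?_ (by positivity)
  · filter_upwards [ae_restrict_mem measurableSet_Ioi] with r (hr : 0 < r)
    simp only [Pi.zero_apply]
    positivity
  · have h := integral_rpow_mul_exp_neg_mul_rpow (p := 2) (q := p - 1) two_pos (by linarith) ht
    simp only [rpow_two, neg_mul, sub_add_cancel] at h
    rw [h, neg_div]
    ring

/-- The Beta integral of the second kind, in the variable `r = √u`. -/
lemma lintegral_rpow_mul_one_add_sq {p q : ℝ} (hp : 0 < p) (hq : 0 < q) :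
    ∫⁻ r in Set.Ioi (0 : ℝ), ENNReal.ofReal (r ^ (p - 1) * (1 + r ^ 2) ^ (-(p + q) / 2)) =
      ENNReal.ofReal (Gamma (p / 2) * Gamma (q / 2) / (2 * Gamma ((p + q) / 2))) := by
  have hG : 0 < Gamma ((p + q) / 2) := Gamma_pos_of_pos (by positivity)
  have hGp : 0 < Gamma (p / 2) := Gamma_pos_of_pos (by positivity)
  have hGq : 0 < Gamma (q / 2) := Gamma_pos_of_pos (by positivity)
  suffices h : ENNReal.ofReal (Gamma ((p + q) / 2)) *
      ∫⁻ r in Set.Ioi (0 : ℝ), ENNReal.ofReal (r ^ (p - 1) * (1 + r ^ 2) ^ (-(p + q) / 2)) =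
      ENNReal.ofReal (Gamma (p / 2) / 2 * Gamma (q / 2)) by
    rw [← ENNReal.mul_right_inj (a := ENNReal.ofReal (Gamma ((p + q) / 2))) (by simpa using hG)
      ENNReal.ofReal_ne_top, h, ← ENNReal.ofReal_mul hG.le]
    congr 1
    field_simp
  calc
    _ = ∫⁻ r in Set.Ioi (0 : ℝ), ∫⁻ t in Set.Ioi (0 : ℝ), ENNReal.ofReal
          (r ^ (p - 1) * (t ^ ((p + q) / 2 - 1) * rexp (-((1 + r ^ 2) * t)))) := by
      rw [← lintegral_const_mul _ (by fun_prop)]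
      refine setLIntegral_congr_fun measurableSet_Ioi fun r (hr : 0 < r) => ?_
      have h := lintegral_rpow_mul_exp_neg_mul (a := (p + q) / 2) (b := 1 + r ^ 2)
        (by positivity) (by positivity)
      simp_rw [ENNReal.ofReal_mul (p := r ^ (p - 1)) (by positivity)]
      rw [lintegral_const_mul _ (by fun_prop), h, ← ENNReal.ofReal_mul (by positivity),
        ← ENNReal.ofReal_mul (by positivity), ← ENNReal.ofReal_mul (by positivity), neg_div]
      congr 1
      ring
    _ = ∫⁻ t in Set.Ioi (0 : ℝ), ∫⁻ r in Set.Ioi (0 : ℝ), ENNReal.ofReal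
          (r ^ (p - 1) * (t ^ ((p + q) / 2 - 1) * rexp (-((1 + r ^ 2) * t)))) :=
      lintegral_lintegral_swap (by fun_prop)
    _ = ∫⁻ t in Set.Ioi (0 : ℝ), ENNReal.ofReal (Gamma (p / 2) / 2) *
          ENNReal.ofReal (t ^ (q / 2 - 1) * rexp (-(1 * t))) := by
      refine setLIntegral_congr_fun measurableSet_Ioi fun t (ht : 0 < t) => ?_
      have h1 (r : ℝ) : r ^ (p - 1) * (t ^ ((p + q) / 2 - 1) * rexp (-((1 + r ^ 2) * t))) =
          (t ^ ((p + q) / 2 - 1) * rexp (-t)) * (r ^ (p - 1) * rexp (-(t * r ^ 2))) := by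
        rw [show -((1 + r ^ 2) * t) = -t + -(t * r ^ 2) by ring, exp_add]
        ring
      simp_rw [h1, ENNReal.ofReal_mul (p := t ^ ((p + q) / 2 - 1) * rexp (-t)) (by positivity)]
      rw [lintegral_const_mul _ (by fun_prop), lintegral_rpow_mul_exp_neg_mul_sq hp ht,
        ← ENNReal.ofReal_mul (by positivity), ← ENNReal.ofReal_mul (by positivity),
        show q / 2 - 1 = ((p + q) / 2 - 1) + -(p / 2) by ring, rpow_add ht]
      congr 1
      ring_nf
    _ = _ := by
      rw [lintegral_const_mul _ (by fun_prop),
        lintegral_rpow_mul_exp_neg_mul (half_pos hq) one_pos, one_rpow, one_mul,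
        ← ENNReal.ofReal_mul (by positivity)]

lemma integrableOn_rpow_mul_one_add_sq {p q : ℝ} (hp : 0 < p) (hq : 0 < q) :
    IntegrableOn (fun r : ℝ => r ^ (p - 1) * (1 + r ^ 2) ^ (-(p + q) / 2)) (Set.Ioi 0) := by
  refine ⟨by fun_prop, ?_⟩
  rw [hasFiniteIntegral_iff_ofReal, lintegral_rpow_mul_one_add_sq hp hq]
  · exact ENNReal.ofReal_lt_top
  · filter_upwards [ae_restrict_mem measurableSet_Ioi] with r (hr : 0 < r)
    simp only [Pi.zero_apply]
    positivity

lemma integral_rpow_mul_one_add_sq {p q : ℝ} (hp : 0 < p) (hq : 0 < q) :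
    ∫ r in Set.Ioi (0 : ℝ), r ^ (p - 1) * (1 + r ^ 2) ^ (-(p + q) / 2) =
      Gamma (p / 2) * Gamma (q / 2) / (2 * Gamma ((p + q) / 2)) := by
  have hG : 0 < Gamma ((p + q) / 2) := Gamma_pos_of_pos (by positivity)
  have hGp : 0 < Gamma (p / 2) := Gamma_pos_of_pos (by positivity)
  have hGq : 0 < Gamma (q / 2) := Gamma_pos_of_pos (by positivity)
  rw [integral_eq_lintegral_of_nonneg_ae _ (by fun_prop), lintegral_rpow_mul_one_add_sq hp hq,
    ENNReal.toReal_ofReal (by positivity)]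
  filter_upwards [ae_restrict_mem measurableSet_Ioi] with r (hr : 0 < r)
  simp only [Pi.zero_apply]
  positivity

lemma lintegral_add_sq_rpow {c q : ℝ} (hc : 0 < c) (hq : 0 < q) :
    ∫⁻ y : ℝ, ENNReal.ofReal ((c + y ^ 2) ^ (-(1 + q) / 2)) =
      ENNReal.ofReal (c ^ (-q / 2) * (√π * Gamma (q / 2) / Gamma ((1 + q) / 2))) := by
  have hG : 0 < Gamma ((1 + q) / 2) := Gamma_pos_of_pos (by positivity)
  have hGq : 0 < Gamma (q / 2) := Gamma_pos_of_pos (by positivity)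
  have hπ := pi_pos
  refine lintegral_ofReal_of_integral_pos (.of_forall fun y => by
    simp only [Pi.zero_apply]; positivity) ?_ (by positivity)
  have h1 : ∫ y : ℝ, (1 + y ^ 2) ^ (-(1 + q) / 2) =
      √π * Gamma (q / 2) / Gamma ((1 + q) / 2) := by
    have h := integral_comp_abs (f := fun y : ℝ => (1 + y ^ 2) ^ (-(1 + q) / 2))
    have h' := integral_rpow_mul_one_add_sq one_pos hq
    simp only [sub_self, rpow_zero, one_mul, Gamma_one_half_eq] at h'
    simp only [sq_abs] at h
    rw [h, h']
    field_simp
  have hs : 0 < √c := sqrt_pos.2 hc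
  have h2 := Measure.integral_comp_mul_left (fun y : ℝ => (c + y ^ 2) ^ (-(1 + q) / 2)) √c
  have h3 (y : ℝ) : (c + (√c * y) ^ 2) ^ (-(1 + q) / 2) =
      c ^ (-(1 + q) / 2) * (1 + y ^ 2) ^ (-(1 + q) / 2) := by
    rw [← mul_rpow hc.le (by positivity), mul_pow, sq_sqrt hc.le]
    ring_nf
  simp_rw [h3] at h2
  rw [integral_const_mul, h1, abs_of_pos (by positivity), smul_eq_mul, eq_inv_mul_iff_mul_eq₀ hs.ne']
    at h2
  rw [← h2, ← mul_assoc]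
  congr 1
  rw [sqrt_eq_rpow, ← rpow_add hc]
  congr 1
  ring

/-- The density of `betaIIRowMeasure` as a real-valued function of the squared norm. -/
noncomputable def betaIIDensity (N : ℕ) (ω s : ℝ) : ℝ :=
  π ^ (-(N : ℝ) / 2) * (Gamma ((ω + N) / 2) / Gamma (ω / 2)) * (1 + s) ^ (-((N : ℝ) + ω) / 2)

@[fun_prop]
lemma measurable_betaIIDensity (N : ℕ) (ω : ℝ) : Measurable (betaIIDensity N ω) := by
  unfold betaIIDensity
  fun_prop

lemma betaIIDensity_nonneg (N : ℕ) {ω s : ℝ} (hω : 0 < ω) (hs : 0 ≤ s) :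
    0 ≤ betaIIDensity N ω s := by
  have hG : 0 < Gamma ((ω + N) / 2) := Gamma_pos_of_pos (by positivity)
  have hGq : 0 < Gamma (ω / 2) := Gamma_pos_of_pos (by positivity)
  have := pi_pos
  unfold betaIIDensity
  positivity

lemma betaIIRowMeasure_eq (N : ℕ) (ω : ℝ) : betaIIRowMeasure N ω =
    volume.withDensity fun x => ENNReal.ofReal (betaIIDensity N ω (∑ j, x j ^ 2)) := rfl

/-- Polar coordinates for the weighted radial power `|x|^s`, written as `exp (s log |x|)`. -/
lemma pow_mul_betaIIDensity_mul_exp {N : ℕ} (hN : 0 < N) (ω s : ℝ) {r : ℝ} (hr : 0 < r) :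
    r ^ (N - 1) * (betaIIDensity N ω (r ^ 2) * rexp (s * log r)) =
      π ^ (-(N : ℝ) / 2) * (Gamma ((ω + N) / 2) / Gamma (ω / 2)) *
        (r ^ ((N + s) - 1) * (1 + r ^ 2) ^ (-((N + s) + (ω - s)) / 2)) := by
  have h1 : r ^ (N - 1) = r ^ ((N : ℝ) - 1) := by
    rw [← rpow_natCast, Nat.cast_sub hN, Nat.cast_one]
  rw [h1, mul_comm s, ← rpow_def_of_pos hr, show (N + s) - 1 = ((N : ℝ) - 1) + s by ring,
    rpow_add hr, betaIIDensity, add_add_sub_cancel]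
  ring

lemma integrable_betaIIRowMeasure_iff {N : ℕ} {ω : ℝ} (hω : 0 < ω) (g : ℝ → ℝ) :
    Integrable (fun x : Fin N → ℝ => g √(∑ j, x j ^ 2)) (betaIIRowMeasure N ω) ↔
      Integrable fun x : EuclideanSpace ℝ (Fin N) => betaIIDensity N ω (‖x‖ ^ 2) * g ‖x‖ := by
  rw [betaIIRowMeasure_eq, integrable_withDensity_iff_integrable_smul' (by fun_prop) (by simp),
    ← (EuclideanSpace.volume_preserving_symm_measurableEquiv_toLp (Fin N)).integrable_comp_emb
      (MeasurableEquiv.measurableEmbedding _)]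
  refine integrable_congr (.of_forall fun x => ?_)
  have h : ∑ j, x j ^ 2 = ‖x‖ ^ 2 := by simp [EuclideanSpace.real_norm_sq_eq]
  simp [h, betaIIDensity_nonneg N hω]

lemma integral_betaIIRowMeasure_radial {N : ℕ} {ω : ℝ} (hω : 0 < ω) (g : ℝ → ℝ) :
    ∫ x : Fin N → ℝ, g √(∑ j, x j ^ 2) ∂betaIIRowMeasure N ω =
      ∫ x : EuclideanSpace ℝ (Fin N), betaIIDensity N ω (‖x‖ ^ 2) * g ‖x‖ := by
  rw [betaIIRowMeasure_eq, integral_withDensity_eq_integral_toReal_smul (by fun_prop) (by simp),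
    ← (EuclideanSpace.volume_preserving_symm_measurableEquiv_toLp (Fin N)).integral_comp']
  refine integral_congr_ae (.of_forall fun x => ?_)
  have h : ∑ j, x j ^ 2 = ‖x‖ ^ 2 := by simp [EuclideanSpace.real_norm_sq_eq]
  simp [h, betaIIDensity_nonneg N hω]

lemma integrable_exp_mul_log_norm {N : ℕ} (hN : 0 < N) {ω s : ℝ} (hω : 0 < ω)
    (hs : -(N : ℝ) < s) (hs' : s < ω) :
    Integrable (fun x : Fin N → ℝ => rexp (s * log √(∑ j, x j ^ 2))) (betaIIRowMeasure N ω) := by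
  have : Nonempty (Fin N) := ⟨⟨0, hN⟩⟩
  rw [integrable_betaIIRowMeasure_iff hω fun r => rexp (s * log r),
    integrable_fun_norm_addHaar volume (f := fun r => betaIIDensity N ω (r ^ 2) * rexp (s * log r))]
  simp only [finrank_euclideanSpace, Fintype.card_fin, smul_eq_mul]
  rw [integrableOn_congr_fun (fun r (hr : r ∈ Set.Ioi 0) => pow_mul_betaIIDensity_mul_exp
    hN ω s hr) measurableSet_Ioi]
  exact (integrableOn_rpow_mul_one_add_sq (by linarith) (by linarith)).const_mul _

lemma integral_exp_mul_log_norm {N : ℕ} (hN : 0 < N) {ω s : ℝ} (hω : 0 < ω)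
    (hs : -(N : ℝ) < s) (hs' : s < ω) :
    ∫ x : Fin N → ℝ, rexp (s * log √(∑ j, x j ^ 2)) ∂betaIIRowMeasure N ω =
      Gamma ((N + s) / 2) * Gamma ((ω - s) / 2) / (Gamma (N / 2) * Gamma (ω / 2)) := by
  have : Nonempty (Fin N) := ⟨⟨0, hN⟩⟩
  have hN' : (0 : ℝ) < N := by exact_mod_cast hN
  have hG : 0 < Gamma ((ω + N) / 2) := Gamma_pos_of_pos (by positivity)
  have hGω : 0 < Gamma (ω / 2) := Gamma_pos_of_pos (by positivity)
  have hGN : 0 < Gamma ((N : ℝ) / 2) := Gamma_pos_of_pos (by positivity)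
  rw [integral_betaIIRowMeasure_radial hω fun r => rexp (s * log r),
    integral_fun_norm_addHaar volume fun r => betaIIDensity N ω (r ^ 2) * rexp (s * log r)]
  simp only [finrank_euclideanSpace, Fintype.card_fin, smul_eq_mul, nsmul_eq_mul]
  rw [setIntegral_congr_fun measurableSet_Ioi fun r hr => pow_mul_betaIIDensity_mul_exp hN ω s hr,
    integral_const_mul, integral_rpow_mul_one_add_sq (by linarith) (by linarith),
    measureReal_def, EuclideanSpace.volume_ball, Fintype.card_fin, ENNReal.ofReal_one, one_pow,
    one_mul, Gamma_add_one (by positivity), ENNReal.toReal_ofReal (by positivity),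
    add_add_sub_cancel, add_comm ω]
  have hπ : π ^ (-(N : ℝ) / 2) * √π ^ N = 1 := by
    rw [sqrt_eq_rpow, ← rpow_natCast, ← rpow_mul pi_pos.le, ← rpow_add pi_pos]
    ring_nf
    exact rpow_zero _
  rw [add_comm ω] at hG
  rw [← mul_one (_ / (Gamma ((N : ℝ) / 2) * _)), ← hπ]
  field_simp

lemma isProbabilityMeasure_betaIIRowMeasure_of_pos {N : ℕ} (hN : 0 < N) {ω : ℝ} (hω : 0 < ω) :
    IsProbabilityMeasure (betaIIRowMeasure N ω) := by
  have hN' : (0 : ℝ) < N := by exact_mod_cast hN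
  have h := integral_exp_mul_log_norm hN hω (s := 0) (by linarith) hω
  have hGω : 0 < Gamma (ω / 2) := Gamma_pos_of_pos (by positivity)
  have hGN : 0 < Gamma ((N : ℝ) / 2) := Gamma_pos_of_pos (by positivity)
  simp only [zero_mul, exp_zero, integral_const, smul_eq_mul, mul_one, add_zero, sub_zero] at h
  rw [div_self (by positivity)] at h
  constructor
  rwa [measureReal_def, ENNReal.toReal_eq_one_iff] at h

lemma isProbabilityMeasure_betaIIRowMeasure (N : ℕ) {ω : ℝ} (hω : 0 < ω) :
    IsProbabilityMeasure (betaIIRowMeasure N ω) := by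
  rcases Nat.eq_zero_or_pos N with rfl | hN
  · have hGω : 0 < Gamma (ω / 2) := Gamma_pos_of_pos (by positivity)
    constructor
    simp [betaIIRowMeasure, div_self hGω.ne', volume_pi]
  · exact isProbabilityMeasure_betaIIRowMeasure_of_pos hN hω

lemma hasDerivAt_Gamma_digamma {x : ℝ} (hx : 0 < x) :
    HasDerivAt Gamma (Gamma x * digamma x) x := by
  have h : DifferentiableAt ℝ Gamma x := differentiableAt_Gamma fun m => by
    have : (0 : ℝ) ≤ m := m.cast_nonneg
    linarith
  have hG := Gamma_pos_of_pos hx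
  have hd : Gamma x * digamma x = deriv Gamma x := by
    rw [show digamma x = _ from deriv.log h hG.ne', mul_div_cancel₀ _ hG.ne']
  exact hd ▸ h.hasDerivAt

lemma integrable_and_integral_log_norm {N : ℕ} (hN : 0 < N) {ω : ℝ} (hω : 0 < ω) :
    Integrable (fun x : Fin N → ℝ => log √(∑ j, x j ^ 2)) (betaIIRowMeasure N ω) ∧
    ∫ x : Fin N → ℝ, log √(∑ j, x j ^ 2) ∂betaIIRowMeasure N ω =
      1 / 2 * (digamma (N / 2) - digamma (ω / 2)) := by
  have hN' : (0 : ℝ) < N := by exact_mod_cast hN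
  have hGω : 0 < Gamma (ω / 2) := Gamma_pos_of_pos (by positivity)
  have hGN : 0 < Gamma ((N : ℝ) / 2) := Gamma_pos_of_pos (by positivity)
  have hnhds : Set.Ioo (-(N : ℝ)) ω ∈ nhds (0 : ℝ) := Ioo_mem_nhds (by linarith) hω
  have hmem : 0 ∈ interior (ProbabilityTheory.integrableExpSet
      (fun x : Fin N → ℝ => log √(∑ j, x j ^ 2)) (betaIIRowMeasure N ω)) :=
    mem_interior_iff_mem_nhds.2 <| Filter.mem_of_superset hnhds fun s hs =>
      integrable_exp_mul_log_norm hN hω hs.1 hs.2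
  refine ⟨ProbabilityTheory.integrable_of_mem_interior_integrableExpSet hmem, ?_⟩
  rw [← ProbabilityTheory.deriv_mgf_zero hmem]
  have hev : ProbabilityTheory.mgf (fun x : Fin N → ℝ => log √(∑ j, x j ^ 2))
      (betaIIRowMeasure N ω) =ᶠ[nhds 0] fun s =>
      Gamma ((N + s) / 2) * Gamma ((ω - s) / 2) / (Gamma (N / 2) * Gamma (ω / 2)) := by
    filter_upwards [hnhds] with s hs
    exact integral_exp_mul_log_norm hN hω hs.1 hs.2
  rw [hev.deriv_eq]
  have h1 : HasDerivAt (fun s : ℝ => Gamma ((N + s) / 2))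
      (Gamma (N / 2) * digamma (N / 2) * (1 / 2)) 0 := by
    refine HasDerivAt.comp (h₂ := Gamma) 0 ?_ (((hasDerivAt_id (0 : ℝ)).const_add (N : ℝ)).div_const 2)
    simpa using hasDerivAt_Gamma_digamma (half_pos hN')
  have h2 : HasDerivAt (fun s : ℝ => Gamma ((ω - s) / 2))
      (Gamma (ω / 2) * digamma (ω / 2) * (-1 / 2)) 0 := by
    refine HasDerivAt.comp (h₂ := Gamma) 0 ?_ (((hasDerivAt_id (0 : ℝ)).const_sub ω).div_const 2)
    simpa using hasDerivAt_Gamma_digamma (half_pos hω)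
  refine ((h1.mul h2).div_const _).deriv.trans ?_
  simp only [add_zero, sub_zero]
  field_simp
  ring

lemma measurePreserving_withDensity {α β : Type*} [MeasurableSpace α] [MeasurableSpace β]
    {μ : Measure α} {ν : Measure β} {T : α → β} (hT : MeasurePreserving T μ ν)
    {f : β → ENNReal} (hf : Measurable f) :
    MeasurePreserving T (μ.withDensity (f ∘ T)) (ν.withDensity f) := by
  refine ⟨hT.measurable, Measure.ext fun s hs => ?_⟩
  rw [Measure.map_apply hT.measurable hs, withDensity_apply _ (hT.measurable hs),
    withDensity_apply _ hs, ← hT.setLIntegral_comp_preimage hs hf]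
  rfl

lemma sum_vecMul_sq {n : Type*} [Fintype n] [DecidableEq n] {Q : Matrix n n ℝ}
    (hQ : Q * Q.transpose = 1) (x : n → ℝ) : ∑ j, (Matrix.vecMul x Q) j ^ 2 = ∑ j, x j ^ 2 := by
  have h : Matrix.vecMul x Q ⬝ᵥ Matrix.vecMul x Q = x ⬝ᵥ x := by
    rw [← Matrix.dotProduct_mulVec, ← Matrix.vecMul_transpose, Matrix.vecMul_vecMul, hQ,
      Matrix.vecMul_one]
  simpa [dotProduct, sq] using h

lemma abs_det_eq_one_of_mul_transpose {n : Type*} [Fintype n] [DecidableEq n] {Q : Matrix n n ℝ}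
    (hQ : Q * Q.transpose = 1) : |Q.det| = 1 := by
  have h := congrArg Matrix.det hQ
  rw [Matrix.det_mul, Matrix.det_transpose, Matrix.det_one, ← abs_mul_abs_self] at h
  nlinarith [abs_nonneg Q.det]

lemma measurePreserving_vecMul {N : ℕ} {Q : Matrix (Fin N) (Fin N) ℝ} (hQ : Q * Q.transpose = 1)
    (ω : ℝ) : MeasurePreserving (fun x => Matrix.vecMul x Q) (betaIIRowMeasure N ω)
      (betaIIRowMeasure N ω) := by
  have hdet := abs_det_eq_one_of_mul_transpose hQ
  have hvol : MeasurePreserving (fun x : Fin N → ℝ => Matrix.vecMul x Q) := by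
    have h := map_matrix_volume_pi_eq_smul_volume_pi (M := Q.transpose) (by
      rw [Matrix.det_transpose]; intro h0; simp [h0] at hdet)
    have hT : (fun x : Fin N → ℝ => Matrix.vecMul x Q) = Matrix.toLin' Q.transpose := by
      ext x
      simp [Matrix.mulVec_transpose]
    rw [Matrix.det_transpose, abs_inv, hdet, inv_one, ENNReal.ofReal_one, one_smul] at h
    rw [hT]
    exact ⟨(LinearMap.continuous_of_finiteDimensional _).measurable, h⟩
  have h := measurePreserving_withDensity hvol
    (f := fun x => ENNReal.ofReal (betaIIDensity N ω (∑ j, x j ^ 2))) (by fun_prop)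
  simpa only [Function.comp_def, sum_vecMul_sq hQ, ← betaIIRowMeasure_eq] using h

/-- The last `N` coordinates of a beta type II vector in `ℝ^(N+1)` are again beta type II. -/
lemma measurePreserving_tail (N : ℕ) {ω : ℝ} (hω : 0 < ω) :
    MeasurePreserving (fun (x : Fin (N + 1) → ℝ) j => x (Fin.succ j)) (betaIIRowMeasure (N + 1) ω)
      (betaIIRowMeasure N ω) := by
  have hmeas : Measurable fun (x : Fin (N + 1) → ℝ) (j : Fin N) => x (Fin.succ j) := by fun_prop
  have hG : 0 < Gamma ((1 + (N + ω)) / 2) := Gamma_pos_of_pos (by positivity)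
  have hGN : 0 < Gamma ((N + ω) / 2) := Gamma_pos_of_pos (by positivity)
  have hGω : 0 < Gamma (ω / 2) := Gamma_pos_of_pos (by positivity)
  have hπ := pi_pos
  refine ⟨hmeas, Measure.ext fun s hs => ?_⟩
  have hmarg (x : Fin N → ℝ) : ∫⁻ y : ℝ, ENNReal.ofReal
      (betaIIDensity (N + 1) ω (y ^ 2 + ∑ j, x j ^ 2)) =
      ENNReal.ofReal (betaIIDensity N ω (∑ j, x j ^ 2)) := by
    have h := lintegral_add_sq_rpow (c := 1 + ∑ j, x j ^ 2) (q := N + ω) (by positivity)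
      (by positivity)
    have h1 (y : ℝ) : betaIIDensity (N + 1) ω (y ^ 2 + ∑ j, x j ^ 2) =
        π ^ (-((N + 1 : ℕ) : ℝ) / 2) * (Gamma ((ω + (N + 1 : ℕ)) / 2) / Gamma (ω / 2)) *
          ((1 + ∑ j, x j ^ 2) + y ^ 2) ^ (-(1 + (N + ω)) / 2) := by
      rw [betaIIDensity]
      push_cast
      ring_nf
    have h2 : Gamma ((ω + (N + 1 : ℕ)) / 2) = Gamma ((1 + (N + ω)) / 2) := by
      push_cast
      ring_nf
    simp_rw [h1, h2]
    simp_rw [ENNReal.ofReal_mul (p := π ^ (-((N + 1 : ℕ) : ℝ) / 2) *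
      (Gamma ((1 + (N + ω)) / 2) / Gamma (ω / 2))) (by positivity)]
    rw [lintegral_const_mul _ (by fun_prop), h, ← ENNReal.ofReal_mul (by positivity),
      betaIIDensity]
    have h3 : π ^ (-((N + 1 : ℕ) : ℝ) / 2) * √π = π ^ (-(N : ℝ) / 2) := by
      rw [sqrt_eq_rpow, ← rpow_add hπ]
      push_cast
      ring_nf
    rw [← h3, add_comm ω, neg_div, neg_div]
    congr 1
    field_simp
  rw [Measure.map_apply hmeas hs, betaIIRowMeasure_eq, betaIIRowMeasure_eq,
    withDensity_apply _ (hmeas hs), withDensity_apply _ hs]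
  have hvol := volume_preserving_piFinSuccAbove (fun _ : Fin (N + 1) => ℝ) 0
  have hsum (x : Fin (N + 1) → ℝ) : ∑ j, x j ^ 2 =
      (MeasurableEquiv.piFinSuccAbove (fun _ : Fin (N + 1) => ℝ) 0 x).1 ^ 2 +
      ∑ j, (MeasurableEquiv.piFinSuccAbove (fun _ : Fin (N + 1) => ℝ) 0 x).2 j ^ 2 := by
    rw [Fin.sum_univ_succ]
    rfl
  simp_rw [hsum]
  have hpre : (fun (x : Fin (N + 1) → ℝ) (j : Fin N) => x (Fin.succ j)) ⁻¹' s =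
      MeasurableEquiv.piFinSuccAbove (fun _ : Fin (N + 1) => ℝ) 0 ⁻¹' (Set.univ ×ˢ s) := by
    ext x
    simp only [Set.mem_preimage, Set.mem_prod, Set.mem_univ, true_and]
    rfl
  rw [hpre, hvol.setLIntegral_comp_preimage (MeasurableSet.univ.prod hs)
    (f := fun p => ENNReal.ofReal (betaIIDensity (N + 1) ω (p.1 ^ 2 + ∑ j, p.2 j ^ 2)))
    (by fun_prop), Measure.volume_eq_prod, ← Measure.prod_restrict, Measure.restrict_univ,
    lintegral_prod_symm' _ (by fun_prop)]
  exact lintegral_congr fun x => hmarg x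

/-- Any vector can be rotated onto the first coordinate axis. -/
lemma exists_orthogonal_vecMul_eq {N : ℕ} (x : Fin (N + 1) → ℝ) :
    ∃ Q : Matrix (Fin (N + 1)) (Fin (N + 1)) ℝ, Q * Q.transpose = 1 ∧
      Matrix.vecMul x Q = Pi.single 0 √(∑ j, x j ^ 2) := by
  set v : EuclideanSpace ℝ (Fin (N + 1)) := WithLp.toLp 2 x with hv
  have hnorm : ‖v‖ = √(∑ j, x j ^ 2) := by simp [hv, EuclideanSpace.norm_eq]
  obtain ⟨b, hb⟩ : ∃ b : OrthonormalBasis (Fin (N + 1)) ℝ (EuclideanSpace ℝ (Fin (N + 1))),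
      v = ‖v‖ • b 0 := by
    by_cases h0 : v = 0
    · exact ⟨EuclideanSpace.basisFun _ _, by simp [h0]⟩
    · have hn : ‖v‖ ≠ 0 := norm_ne_zero_iff.2 h0
      obtain ⟨b, hb⟩ := Orthonormal.exists_orthonormalBasis_extension_of_card_eq (𝕜 := ℝ)
        (E := EuclideanSpace ℝ (Fin (N + 1))) (ι := Fin (N + 1)) (by simp)
        (v := fun _ => ‖v‖⁻¹ • v) (s := {0}) (by
          rw [orthonormal_subsingleton_iff]
          intro i
          simp [norm_smul, hn])
      exact ⟨b, by rw [hb 0 rfl, smul_inv_smul₀ hn]⟩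
  refine ⟨Matrix.of fun i j => b j i, ?_, ?_⟩
  · rw [mul_eq_one_comm]
    ext i j
    have h := b.inner_eq_ite i j
    simp only [PiLp.inner_apply, RCLike.inner_apply, conj_trivial] at h
    rw [Matrix.mul_apply, Matrix.one_apply, ← h]
    simp [mul_comm]
  · ext j
    have h : inner ℝ (b j) v = ‖v‖ * if j = 0 then 1 else 0 := by
      conv_lhs => rw [hb]
      rw [inner_smul_right, b.inner_eq_ite]
    simp only [PiLp.inner_apply, RCLike.inner_apply, conj_trivial] at h
    rw [← hnorm, Pi.single_apply]
    simpa [Matrix.vecMul, dotProduct, hv] using h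

/-- The square matrix obtained by deleting the first column of an `N × (N+1)` matrix. -/
def dropFirstColumn {N : ℕ} (M : Fin N → Fin (N + 1) → ℝ) : Fin N → Fin N → ℝ :=
  fun i j => M i (Fin.succ j)

lemma abs_det_cons_of_vecMul_eq {N : ℕ} {x : Fin (N + 1) → ℝ} {c : ℝ}
    {Q : Matrix (Fin (N + 1)) (Fin (N + 1)) ℝ} (hQ : Q * Q.transpose = 1)
    (hx : Matrix.vecMul x Q = Pi.single 0 c) (M : Fin N → Fin (N + 1) → ℝ) :
    |(Matrix.of (Fin.cons x M : Fin (N + 1) → Fin (N + 1) → ℝ)).det| =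
      |c| * |(Matrix.of (dropFirstColumn fun i => Matrix.vecMul (M i) Q)).det| := by
  have hdet := abs_det_eq_one_of_mul_transpose hQ
  have hrow (i : Fin (N + 1)) : (Matrix.of (Fin.cons x M : Fin (N + 1) → Fin (N + 1) → ℝ) * Q) i =
      Matrix.vecMul ((Fin.cons x M : Fin (N + 1) → Fin (N + 1) → ℝ) i) Q := rfl
  have hminor : (Matrix.of (Fin.cons x M : Fin (N + 1) → Fin (N + 1) → ℝ) * Q).submatrix
      Fin.succ Fin.succ = Matrix.of (dropFirstColumn fun i => Matrix.vecMul (M i) Q) := rfl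
  rw [← mul_one |Matrix.det _|, ← hdet, ← abs_mul, ← Matrix.det_mul, Matrix.det_succ_row_zero,
    Fin.sum_univ_succ, ← abs_mul, ← hminor]
  simp [hrow, hx]

lemma measurable_abs_det (N : ℕ) :
    Measurable fun M : Fin N → Fin N → ℝ => |(Matrix.of M).det| :=
  Continuous.measurable (continuous_abs.comp (Continuous.matrix_det
    (continuous_matrix fun i j => by simp only [Matrix.of_apply]; fun_prop)))

lemma measurable_norm_mul_abs_det (N : ℕ) :
    Measurable fun p : (Fin (N + 1) → ℝ) × (Fin N → Fin N → ℝ) =>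
      √(∑ j, p.1 j ^ 2) * |(Matrix.of p.2).det| :=
  Measurable.mul (by fun_prop) ((measurable_abs_det N).comp measurable_snd)

lemma map_abs_det_cons {N : ℕ} (μ : Measure (Fin (N + 1) → ℝ)) [SFinite μ] (ω : Fin N → ℝ)
    (hω : ∀ l, 0 < ω l) :
    (μ.prod (Measure.pi fun l => betaIIRowMeasure (N + 1) (ω l))).map
        (fun p => |(Matrix.of (Fin.cons p.1 p.2 : Fin (N + 1) → Fin (N + 1) → ℝ)).det|) =
      (μ.prod (Measure.pi fun l => betaIIRowMeasure N (ω l))).map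
        (fun p => √(∑ j, p.1 j ^ 2) * |(Matrix.of p.2).det|) := by
  have := fun l => isProbabilityMeasure_betaIIRowMeasure (N + 1) (hω l)
  have := fun l => isProbabilityMeasure_betaIIRowMeasure N (hω l)
  have hm1 : Measurable fun p : (Fin (N + 1) → ℝ) × (Fin N → Fin (N + 1) → ℝ) =>
      |(Matrix.of (Fin.cons p.1 p.2 : Fin (N + 1) → Fin (N + 1) → ℝ)).det| := by
    refine Continuous.measurable (continuous_abs.comp (Continuous.matrix_det ?_))
    refine continuous_matrix fun i j => ?_
    refine Fin.cases ?_ (fun i => ?_) i <;> simp <;> fun_prop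
  have hm2 := measurable_norm_mul_abs_det N
  refine Measure.ext fun s hs => ?_
  rw [Measure.map_apply hm1 hs, Measure.map_apply hm2 hs, Measure.prod_apply (hm1 hs),
    Measure.prod_apply (hm2 hs)]
  refine lintegral_congr fun x => ?_
  obtain ⟨Q, hQ, hx⟩ := exists_orthogonal_vecMul_eq x
  have hrows : MeasurePreserving
      (fun M : Fin N → Fin (N + 1) → ℝ => dropFirstColumn fun i => Matrix.vecMul (M i) Q)
      (Measure.pi fun l => betaIIRowMeasure (N + 1) (ω l))
      (Measure.pi fun l => betaIIRowMeasure N (ω l)) :=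
    measurePreserving_pi _ _ fun l =>
      (measurePreserving_tail N (hω l)).comp (measurePreserving_vecMul hQ (ω l))
  rw [← hrows.measure_preimage (measurable_prodMk_left (hm2 hs)).nullMeasurableSet]
  congr 1
  ext M
  simp only [Set.mem_preimage, abs_det_cons_of_vecMul_eq hQ hx, abs_of_nonneg (sqrt_nonneg _)]

/-- In distribution, `|det|` of a beta type II matrix factors as the norm of its first row times
`|det|` of an independent beta type II matrix of size one less. -/
lemma identDistrib_abs_det {N : ℕ} {ω : Fin (N + 1) → ℝ} (hω : ∀ l, 0 < ω l) :
    ProbabilityTheory.IdentDistrib (fun M : Fin (N + 1) → Fin (N + 1) → ℝ => |(Matrix.of M).det|)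
      (fun p : (Fin (N + 1) → ℝ) × (Fin N → Fin N → ℝ) =>
        √(∑ j, p.1 j ^ 2) * |(Matrix.of p.2).det|)
      (Measure.pi fun l => betaIIRowMeasure (N + 1) (ω l))
      ((betaIIRowMeasure (N + 1) (ω 0)).prod
        (Measure.pi fun l : Fin N => betaIIRowMeasure N (ω l.succ))) := by
  have := fun l => isProbabilityMeasure_betaIIRowMeasure (N + 1) (hω l)
  refine ⟨(measurable_abs_det _).aemeasurable, (measurable_norm_mul_abs_det N).aemeasurable, ?_⟩
  rw [← map_abs_det_cons _ _ fun l => hω l.succ]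
  have h := (measurePreserving_piFinSuccAbove (fun l => betaIIRowMeasure (N + 1) (ω l)) 0).symm
  rw [← h.map_eq, Measure.map_map (measurable_abs_det _) (MeasurableEquiv.measurable _)]
  have hcons (p : (Fin (N + 1) → ℝ) × (Fin N → Fin (N + 1) → ℝ)) :
      (MeasurableEquiv.piFinSuccAbove (fun _ => Fin (N + 1) → ℝ) 0).symm p = Fin.cons p.1 p.2 :=
    Fin.insertNth_zero' p.1 p.2
  simp only [Function.comp_def, hcons, Fin.zero_succAbove]

lemma ae_norm_ne_zero (N : ℕ) (ω : ℝ) :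
    ∀ᵐ x ∂betaIIRowMeasure (N + 1) ω, √(∑ j, x j ^ 2) ≠ 0 := by
  have h : ∀ᵐ x : Fin (N + 1) → ℝ, x ≠ 0 := by simp [ae_iff]
  filter_upwards [(withDensity_absolutelyContinuous _ _ : betaIIRowMeasure (N + 1) ω ≪ volume) h]
    with x hx h0
  rw [sqrt_eq_zero (by positivity), Finset.sum_eq_zero_iff_of_nonneg fun _ _ => sq_nonneg _] at h0
  exact hx (funext fun j => by simpa using h0 j (Finset.mem_univ j))

lemma log_abs_det_betaII (N : ℕ) (ω : Fin N → ℝ) (hω : ∀ l, 0 < ω l) :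
    (∀ᵐ M : Fin N → Fin N → ℝ ∂(Measure.pi fun l => betaIIRowMeasure N (ω l)),
      |(Matrix.of M).det| ≠ 0) ∧
    Integrable (fun M : Fin N → Fin N → ℝ => log |(Matrix.of M).det|)
      (Measure.pi fun l => betaIIRowMeasure N (ω l)) ∧
    ∫ M : Fin N → Fin N → ℝ, log |(Matrix.of M).det|
        ∂(Measure.pi fun l => betaIIRowMeasure N (ω l)) =
      1 / 2 * ∑ l : Fin N, (digamma (((N : ℝ) - (l : ℕ)) / 2) - digamma (ω l / 2)) := by
  induction N with
  | zero => simp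
  | succ N ih =>
    obtain ⟨hne, hint, hval⟩ := ih (fun l => ω l.succ) fun l => hω l.succ
    have := isProbabilityMeasure_betaIIRowMeasure (N + 1) (hω 0)
    have := fun l : Fin N => isProbabilityMeasure_betaIIRowMeasure N (hω l.succ)
    obtain ⟨hint0, hval0⟩ := integrable_and_integral_log_norm N.succ_pos (hω 0)
    have hid := identDistrib_abs_det hω
    have hlog := hid.comp measurable_log
    have hfst := (Measure.quasiMeasurePreserving_fst (μ := betaIIRowMeasure (N + 1) (ω 0))
      (ν := Measure.pi fun l : Fin N => betaIIRowMeasure N (ω l.succ))).ae (ae_norm_ne_zero N (ω 0))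
    have hsnd := (Measure.quasiMeasurePreserving_snd (μ := betaIIRowMeasure (N + 1) (ω 0))).ae hne
    have hsplit : (log ∘ fun p : (Fin (N + 1) → ℝ) × (Fin N → Fin N → ℝ) =>
        √(∑ j, p.1 j ^ 2) * |(Matrix.of p.2).det|) =ᵐ[(betaIIRowMeasure (N + 1) (ω 0)).prod
          (Measure.pi fun l : Fin N => betaIIRowMeasure N (ω l.succ))]
        fun p => log √(∑ j, p.1 j ^ 2) + log |(Matrix.of p.2).det| := by
      filter_upwards [hfst, hsnd] with p h1 h2
      exact log_mul h1 h2
    refine ⟨?_, ?_, ?_⟩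
    · refine hid.symm.ae_snd (p := fun y => y ≠ 0) (measurableSet_singleton 0).compl ?_
      filter_upwards [hfst, hsnd] with p h1 h2
      exact mul_ne_zero h1 h2
    · refine hlog.integrable_iff.2 ((integrable_congr hsplit).2 ?_)
      exact (hint0.comp_fst _).add (hint.comp_snd _)
    · refine hlog.integral_eq.trans ((integral_congr_ae hsplit).trans ?_)
      rw [integral_add (hint0.comp_fst _) (hint.comp_snd _),
        integral_fun_fst (fun x : Fin (N + 1) → ℝ => log √(∑ j, x j ^ 2)),
        integral_fun_snd (fun M : Fin N → Fin N → ℝ => log |(Matrix.of M).det|), hval0, hval,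
        Fin.sum_univ_succ]
      simp [mul_add]

theorem statement11 (N : ℕ) (hN : 0 < N) (ω : Fin N → ℝ) (hω : ∀ l, 0 < ω l) :
    Integrable (fun M : Fin N → Fin N → ℝ => Real.log |Matrix.det (Matrix.of M)|)
      (Measure.pi fun l => betaIIRowMeasure N (ω l)) ∧
    ∫ M : Fin N → Fin N → ℝ, Real.log |Matrix.det (Matrix.of M)|
        ∂(Measure.pi fun l => betaIIRowMeasure N (ω l)) =
      (1 / 2) * ∑ l : Fin N,
        (digamma (((N : ℝ) - (l : ℕ)) / 2) - digamma (ω l / 2)) :=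
  (log_abs_det_betaII N ω hω).2
end

section
/- Let β ∈ {1,2,4}, let N₀, N be integers with 1 ≤ N₀ < N, and let b₁, b₂ > 0. Let X₁ and X₂ be independent random variables, where X₁ has the Gamma distribution with shape βN₀/2 and rate b₁ (density b₁^{βN₀/2} x^{βN₀/2−1} e^{−b₁x}/Γ(βN₀/2) on (0,∞)) and X₂ has the Gamma distribution with shape β(N−N₀)/2 and rate b₂. Then the law of X₁ + X₂ has density p(t) = (b₁^{βN₀/2} b₂^{β(N−N₀)/2} / Γ(βN/2)) t^{βN/2−1} e^{−b₂ t} ₁F₁(βN₀/2; βN/2; (b₂−b₁)t) with respect to Lebesgue measure on (0,∞). -/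
open MeasureTheory Real

/-- The Gamma distribution with shape `a` and rate `b`:
the measure on `(0,∞)` with density `b^a x^{a-1} e^{-bx}/Γ(a)`. -/
noncomputable def gammaMeas (a b : ℝ) : Measure ℝ :=
  volume.withDensity fun x =>
    ENNReal.ofReal (if 0 < x then
      b ^ a * x ^ (a - 1) * Real.exp (-b * x) / Real.Gamma a
    else 0)

/-- The ascending factorial (Pochhammer symbol) `(c)_n = c(c+1)⋯(c+n-1)`. -/
noncomputable def risingFactorial (c : ℝ) (n : ℕ) : ℝ :=
  ∏ i ∈ Finset.range n, (c + i)

/-- The confluent hypergeometric function `₁F₁(a;b;z) = Σ_n ((a)_n/(b)_n) zⁿ/n!`. -/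
noncomputable def hyp1F1 (a b z : ℝ) : ℝ :=
  ∑' n : ℕ, (risingFactorial a n / risingFactorial b n) * z ^ n / (n.factorial : ℝ)

open Set

/-- The Beta integral over `(0,t)`. -/
lemma integral_rpow_mul_sub_rpow {a c t : ℝ} (ha : 0 < a) (hc : 0 < c) (ht : 0 < t) :
    ∫ x in Ioo 0 t, x ^ (a - 1) * (t - x) ^ (c - 1) =
      t ^ (a + c - 1) * ProbabilityTheory.beta a c := by
  have h := Complex.betaIntegral_scaled a c ht
  rw [intervalIntegral.integral_of_le ht.le, Complex.betaIntegral_eq_Gamma_mul_div _ _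
    (by simpa using ha) (by simpa using hc)] at h
  rw [← integral_Ioc_eq_integral_Ioo]
  apply Complex.ofReal_injective
  rw [← integral_complex_ofReal]
  convert! h using 1
  · refine setIntegral_congr_fun measurableSet_Ioc fun x hx ↦ ?_
    push_cast [Complex.ofReal_cpow hx.1.le, Complex.ofReal_cpow (sub_nonneg.2 hx.2)]
    rfl
  · rw [ProbabilityTheory.beta]
    push_cast [Complex.ofReal_cpow ht.le, ← Complex.Gamma_ofReal]
    rfl

lemma integrableOn_rpow_mul_sub_rpow {a c t : ℝ} (ha : 0 < a) (hc : 0 < c) (ht : 0 < t) :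
    IntegrableOn (fun x ↦ x ^ (a - 1) * (t - x) ^ (c - 1)) (Ioo 0 t) := by
  refine not_imp_comm.1 integral_undef ?_
  rw [integral_rpow_mul_sub_rpow ha hc ht]
  exact (mul_pos (rpow_pos_of_pos ht _) (ProbabilityTheory.beta_pos ha hc)).ne'

lemma risingFactorial_pos {a : ℝ} (ha : 0 < a) (n : ℕ) : 0 < risingFactorial a n :=
  Finset.prod_pos fun i _ ↦ by positivity

lemma risingFactorial_le {a b : ℝ} (ha : 0 < a) (hab : a ≤ b) (n : ℕ) :
    risingFactorial a n ≤ risingFactorial b n :=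
  Finset.prod_le_prod (fun i _ ↦ by positivity) fun i _ ↦ by gcongr

lemma Gamma_add_natCast {a : ℝ} (ha : 0 < a) (n : ℕ) :
    Gamma (a + n) = risingFactorial a n * Gamma a := by
  induction n with
  | zero => simp [risingFactorial]
  | succ n ih =>
    rw [Nat.cast_succ, ← add_assoc, Gamma_add_one (by positivity), ih, risingFactorial,
      risingFactorial, Finset.prod_range_succ]
    ring

lemma beta_add_natCast {a c : ℝ} (ha : 0 < a) (hc : 0 < c) (n : ℕ) :
    ProbabilityTheory.beta (a + n) c =
      ProbabilityTheory.beta a c * (risingFactorial a n / risingFactorial (a + c) n) := by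
  rw [ProbabilityTheory.beta, ProbabilityTheory.beta, add_right_comm, Gamma_add_natCast ha,
    Gamma_add_natCast (add_pos ha hc)]
  have := risingFactorial_pos (add_pos ha hc) n
  have := Gamma_pos_of_pos (add_pos ha hc)
  field_simp

lemma integral_rpow_add_natCast_mul_sub_rpow {a c t : ℝ} (ha : 0 < a) (hc : 0 < c) (ht : 0 < t)
    (l : ℝ) (n : ℕ) :
    ∫ x in Ioo 0 t, l ^ n / n.factorial * (x ^ (a + n - 1) * (t - x) ^ (c - 1)) =
      t ^ (a + c - 1) * ProbabilityTheory.beta a c *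
        (risingFactorial a n / risingFactorial (a + c) n * (l * t) ^ n / n.factorial) := by
  rw [integral_const_mul, integral_rpow_mul_sub_rpow (by positivity) hc ht,
    beta_add_natCast ha hc, show a + n + c - 1 = a + c - 1 + n by ring,
    rpow_add_natCast ht.ne', mul_pow]
  ring

/-- Euler's integral representation of `₁F₁`, over `(0,t)`. -/
lemma integral_rpow_mul_sub_rpow_mul_exp {a c t : ℝ} (ha : 0 < a) (hc : 0 < c) (ht : 0 < t)
    (l : ℝ) :
    ∫ x in Ioo 0 t, x ^ (a - 1) * (t - x) ^ (c - 1) * exp (l * x) =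
      t ^ (a + c - 1) * ProbabilityTheory.beta a c * hyp1F1 a (a + c) (l * t) := by
  have hsum := hasSum_integral_of_summable_integral_norm (μ := volume.restrict (Ioo 0 t))
    (F := fun (n : ℕ) x ↦ l ^ n / n.factorial * (x ^ (a + n - 1) * (t - x) ^ (c - 1)))
    (fun n ↦ (integrableOn_rpow_mul_sub_rpow (by positivity) hc ht).const_mul _) ?_
  · simp_rw [integral_rpow_add_natCast_mul_sub_rpow ha hc ht] at hsum
    rw [hyp1F1, ← tsum_mul_left, hsum.tsum_eq]
    refine setIntegral_congr_fun measurableSet_Ioo fun x hx ↦ ?_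
    rw [exp_eq_exp_ℝ, NormedSpace.exp_eq_tsum_div, ← tsum_mul_left]
    congr 1 with n
    rw [show a + n - 1 = a - 1 + n by ring, rpow_add_natCast hx.1.ne', mul_pow]
    ring
  · have hnorm (n : ℕ) : ∫ x in Ioo 0 t,
        ‖l ^ n / n.factorial * (x ^ (a + n - 1) * (t - x) ^ (c - 1))‖ =
        t ^ (a + c - 1) * ProbabilityTheory.beta a c *
          (risingFactorial a n / risingFactorial (a + c) n * (|l| * t) ^ n / n.factorial) := by
      rw [← integral_rpow_add_natCast_mul_sub_rpow ha hc ht]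
      refine setIntegral_congr_fun measurableSet_Ioo fun x hx ↦ ?_
      have h₁ := rpow_nonneg hx.1.le (a + n - 1)
      have h₂ := rpow_nonneg (sub_nonneg.2 hx.2.le) (c - 1)
      simp [abs_of_nonneg h₁, abs_of_nonneg h₂]
    simp_rw [hnorm]
    refine Summable.mul_left _ (Summable.of_nonneg_of_le (fun n ↦ ?_) (fun n ↦ ?_)
      (summable_pow_div_factorial (|l| * t)))
    · have := risingFactorial_pos ha n
      have := risingFactorial_pos (add_pos ha hc) n
      positivity
    · gcongr
      exact mul_le_of_le_one_left (by positivity) (div_le_one_of_le₀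
        (risingFactorial_le ha (by linarith) n) (risingFactorial_pos (add_pos ha hc) n).le)

lemma integrableOn_rpow_mul_sub_rpow_mul_exp {a c t : ℝ} (ha : 0 < a) (hc : 0 < c) (ht : 0 < t)
    (l : ℝ) :
    IntegrableOn (fun x ↦ x ^ (a - 1) * (t - x) ^ (c - 1) * exp (l * x)) (Ioo 0 t) := by
  refine ((integrableOn_rpow_mul_sub_rpow ha hc ht).mul_const (exp (|l| * t))).mono'
    (Measurable.aestronglyMeasurable (by fun_prop))
    (ae_restrict_of_forall_mem measurableSet_Ioo fun x hx ↦ ?_)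
  have h₁ := rpow_nonneg hx.1.le (a - 1)
  have h₂ := rpow_nonneg (sub_nonneg.2 hx.2.le) (c - 1)
  rw [norm_of_nonneg (by positivity)]
  gcongr
  · exact hx.1.le
  · exact le_abs_self l
  · exact hx.2.le

/-- The law of the sum of independent Gamma variables of shapes `a`, `c` and rates `b₁`, `b₂`. -/
lemma map_add_prod_gammaMeas {a c b₁ b₂ : ℝ} (ha : 0 < a) (hc : 0 < c) (hb₁ : 0 < b₁)
    (hb₂ : 0 < b₂) :
    Measure.map (fun p : ℝ × ℝ ↦ p.1 + p.2) ((gammaMeas a b₁).prod (gammaMeas c b₂)) =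
      volume.withDensity fun t ↦ ENNReal.ofReal (if 0 < t then
        b₁ ^ a * b₂ ^ c / Gamma (a + c) * t ^ (a + c - 1) * exp (-b₂ * t) *
          hyp1F1 a (a + c) ((b₂ - b₁) * t) else 0) := by
  have hmeas (s b : ℝ) : Measurable fun x : ℝ ↦ ENNReal.ofReal (if 0 < x then
      b ^ s * x ^ (s - 1) * exp (-b * x) / Gamma s else 0) :=
    (Measurable.ite measurableSet_Ioi (by fun_prop) (by fun_prop)).ennreal_ofReal
  refine (conv_withDensity_eq_lconvolution (hmeas a b₁) (hmeas c b₂)).trans ?_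
  congr 1 with t
  have hΓa := Gamma_pos_of_pos ha
  have hΓc := Gamma_pos_of_pos hc
  have hΓ := Gamma_pos_of_pos (add_pos ha hc)
  set C := b₁ ^ a * b₂ ^ c / (Gamma a * Gamma c) * exp (-b₂ * t)
  have hC : 0 ≤ C := by positivity
  have hprod : (fun y : ℝ ↦ ENNReal.ofReal (if 0 < y then
      b₁ ^ a * y ^ (a - 1) * exp (-b₁ * y) / Gamma a else 0) *
      ENNReal.ofReal (if 0 < -y + t then
      b₂ ^ c * (-y + t) ^ (c - 1) * exp (-b₂ * (-y + t)) / Gamma c else 0)) =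
      (Ioo 0 t).indicator fun y ↦ ENNReal.ofReal
        (C * (y ^ (a - 1) * (t - y) ^ (c - 1) * exp ((b₂ - b₁) * y))) := by
    ext y
    by_cases hy : y ∈ Ioo 0 t
    · have hy₀ : 0 < y := hy.1
      have hyt : 0 < -y + t := by linarith [hy.2]
      rw [indicator_of_mem hy, if_pos hy₀, if_pos hyt, ← ENNReal.ofReal_mul (by positivity)]
      have hexp : exp (-b₁ * y) * exp (-b₂ * (-y + t)) =
          exp (-b₂ * t) * exp ((b₂ - b₁) * y) := by
        rw [← exp_add, ← exp_add]
        ring_nf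
      rw [show t - y = -y + t by ring]
      congr 1
      calc _ = b₁ ^ a * b₂ ^ c / (Gamma a * Gamma c) * (y ^ (a - 1) * (-y + t) ^ (c - 1)) *
            (exp (-b₁ * y) * exp (-b₂ * (-y + t))) := by field_simp
        _ = _ := by rw [hexp]; ring
    · rw [indicator_of_notMem hy]
      by_cases hy₀ : 0 < y
      · rw [if_neg (c := 0 < -y + t) fun h ↦ hy ⟨hy₀, by linarith⟩]
        simp
      · rw [if_neg hy₀]
        simp
  rw [lconvolution_def, hprod, lintegral_indicator measurableSet_Ioo]
  by_cases ht : 0 < t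
  · rw [if_pos ht, ← ofReal_integral_eq_lintegral_ofReal
      ((integrableOn_rpow_mul_sub_rpow_mul_exp ha hc ht _).const_mul C)
      (ae_restrict_of_forall_mem measurableSet_Ioo fun x hx ↦ ?_), integral_const_mul,
      integral_rpow_mul_sub_rpow_mul_exp ha hc ht, ProbabilityTheory.beta]
    · congr 1
      simp only [C]
      field_simp
    · have h₁ := rpow_nonneg hx.1.le (a - 1)
      have h₂ := rpow_nonneg (sub_nonneg.2 hx.2.le) (c - 1)
      simp only [Pi.zero_apply]
      positivity
  · simp [Ioo_eq_empty ht, if_neg ht]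

theorem statement12 (β N₀ N : ℕ) (hβ : β = 1 ∨ β = 2 ∨ β = 4)
    (hN₀ : 1 ≤ N₀) (hN : N₀ < N) (b₁ b₂ : ℝ) (hb₁ : 0 < b₁) (hb₂ : 0 < b₂) :
    Measure.map (fun p : ℝ × ℝ => p.1 + p.2)
        ((gammaMeas ((β : ℝ) * N₀ / 2) b₁).prod
          (gammaMeas ((β : ℝ) * ((N : ℝ) - N₀) / 2) b₂)) =
      volume.withDensity fun t =>
        ENNReal.ofReal (if 0 < t then
          b₁ ^ ((β : ℝ) * N₀ / 2) * b₂ ^ ((β : ℝ) * ((N : ℝ) - N₀) / 2) /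
              Real.Gamma ((β : ℝ) * N / 2) *
            t ^ ((β : ℝ) * N / 2 - 1) * Real.exp (-b₂ * t) *
            hyp1F1 ((β : ℝ) * N₀ / 2) ((β : ℝ) * N / 2) ((b₂ - b₁) * t)
        else 0) := by
  have hβ₀ : (0 : ℝ) < β := by
    rcases hβ with rfl | rfl | rfl <;> norm_num
  have hN₀' : (0 : ℝ) < N₀ := by exact_mod_cast hN₀
  have hN' : (0 : ℝ) < (N : ℝ) - N₀ := sub_pos.2 (by exact_mod_cast hN)
  rw [show (β : ℝ) * N / 2 = β * N₀ / 2 + β * ((N : ℝ) - N₀) / 2 by ring]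
  exact map_add_prod_gammaMeas (by positivity) (by positivity) hb₁ hb₂
end

section
/- Let β ∈ {1,2,4}, let N₀, N be integers with 1 ≤ N₀ < N, and let 0 < b₂ ≤ b₁. Let X₁ and X₂ be independent random variables, where X₁ has the Gamma distribution with shape βN₀/2 and rate b₁ and X₂ has the Gamma distribution with shape β(N−N₀)/2 and rate b₂. Then E[log(X₁ + X₂)] = Ψ(βN/2) − log b₂ + (Γ(βN/2)/(Γ(βN₀/2) Γ(β(N−N₀)/2))) ∫₀¹ x^{βN₀/2−1} (1−x)^{β(N−N₀)/2−1} log(1 − (1 − b₂/b₁) x) dx. (One half of this quantity is the largest Lyapunov exponent of the product of i.i.d. Gaussian random matrices with variance profile (b₁,…,b₁,b₂,…,b₂).) -/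
open MeasureTheory Real

open Set ProbabilityTheory

theorem gammaMeas_eq_withDensity_restrict (a b : ℝ) :
    gammaMeas a b = (volume.restrict (Ioi 0)).withDensity fun x =>
      ENNReal.ofReal (b ^ a * x ^ (a - 1) * Real.exp (-b * x) / Real.Gamma a) := by
  rw [gammaMeas, ← withDensity_indicator measurableSet_Ioi]
  congr 1
  ext x
  by_cases hx : 0 < x <;> simp [hx]

theorem gammaMeas_eq_gammaMeasure (a b : ℝ) : gammaMeas a b = gammaMeasure a b := by
  refine withDensity_congr_ae ?_
  filter_upwards [Measure.ae_ne volume (0 : ℝ)] with x hx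
  rw [gammaPDF_eq]
  rcases lt_or_gt_of_ne hx with h | h
  · simp [h.not_gt, h.not_ge]
  · simp only [h, h.le, if_true]
    ring_nf

theorem isProbabilityMeasure_gammaMeas {a b : ℝ} (ha : 0 < a) (hb : 0 < b) :
    IsProbabilityMeasure (gammaMeas a b) :=
  gammaMeas_eq_gammaMeasure a b ▸ isProbabilityMeasure_gammaMeasure ha hb

theorem betaMeasure_eq_withDensity_restrict (a b : ℝ) :
    betaMeasure a b = (volume.restrict (Ioo 0 1)).withDensity fun x =>
      ENNReal.ofReal (1 / beta a b * x ^ (a - 1) * (1 - x) ^ (b - 1)) := by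
  rw [betaMeasure, ← withDensity_indicator measurableSet_Ioo]
  congr 1
  ext x
  by_cases hx : 0 < x ∧ x < 1 <;> simp [betaPDF_eq, hx]

theorem integrableOn_log_mul_and_hasDerivAt_Gamma {a : ℝ} (ha : 0 < a) :
    IntegrableOn (fun t : ℝ => t ^ (a - 1) * (Real.log t * Real.exp (-t))) (Ioi 0) ∧
      HasDerivAt Real.Gamma
        (∫ t in Ioi (0 : ℝ), t ^ (a - 1) * (Real.log t * Real.exp (-t))) a := by
  have hcoe : ∀ t ∈ Ioi (0 : ℝ),
      (t : ℂ) ^ ((a : ℂ) - 1) • Real.log t • ((Real.exp (-t) : ℝ) : ℂ) =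
        ((t ^ (a - 1) * (Real.log t * Real.exp (-t)) : ℝ) : ℂ) := by
    intro t ht
    rw [smul_eq_mul, Complex.real_smul, Complex.ofReal_mul, Complex.ofReal_mul,
      Complex.ofReal_cpow (le_of_lt ht), Complex.ofReal_sub, Complex.ofReal_one]
  have hcont : Continuous fun x : ℝ => ((Real.exp (-x) : ℝ) : ℂ) := by fun_prop
  have key := mellin_hasDerivAt_of_isBigO_rpow (E := ℂ) (a := a + 1) (b := 0) (s := (a : ℂ))
    (f := fun x => ((Real.exp (-x) : ℝ) : ℂ))
    (hcont.continuousOn.locallyIntegrableOn measurableSet_Ioi)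
    (by
      rw [← Asymptotics.isBigO_norm_left]
      simp_rw [Complex.norm_real, Asymptotics.isBigO_norm_left]
      simpa only [neg_one_mul] using (isLittleO_exp_neg_mul_rpow_atTop zero_lt_one _).isBigO)
    (by simp)
    (by
      simp_rw [neg_zero, Real.rpow_zero]
      exact hcont.continuousWithinAt.tendsto.isBigO_one ℝ)
    (by simpa using ha)
  rw [← Complex.GammaIntegral_eq_mellin] at key
  obtain ⟨hconv, hderiv⟩ := key
  constructor
  · have := (integrableOn_congr_fun hcoe measurableSet_Ioi).1 hconv
    exact this.re
  · have hderiv' : HasDerivAt Complex.Gamma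
        ((∫ t in Ioi (0 : ℝ), t ^ (a - 1) * (Real.log t * Real.exp (-t)) : ℝ) : ℂ) (a : ℂ) := by
      rw [← integral_complex_ofReal, ← setIntegral_congr_fun measurableSet_Ioi hcoe]
      refine hderiv.congr_of_eventuallyEq ?_
      have hopen : IsOpen {s : ℂ | 0 < s.re} := Complex.continuous_re.isOpen_preimage _ isOpen_Ioi
      filter_upwards [hopen.mem_nhds (show 0 < (a : ℂ).re by simpa using ha)] with s hs
      exact Complex.Gamma_eq_integral hs
    exact hderiv'.real_of_complex

theorem integrable_log_gammaMeas {a : ℝ} (ha : 0 < a) :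
    Integrable Real.log (gammaMeas a 1) := by
  rw [gammaMeas_eq_withDensity_restrict, integrable_withDensity_iff_integrable_smul'
    (by fun_prop) (by simp)]
  refine ((integrableOn_log_mul_and_hasDerivAt_Gamma ha).1.div_const (Real.Gamma a)).congr ?_
  filter_upwards [ae_restrict_mem measurableSet_Ioi] with t ht
  have ht' : 0 < t := ht
  have hΓ := Real.Gamma_pos_of_pos ha
  rw [ENNReal.toReal_ofReal (by positivity), Real.one_rpow, smul_eq_mul]
  ring_nf

theorem integral_log_gammaMeas {a : ℝ} (ha : 0 < a) :
    ∫ x, Real.log x ∂(gammaMeas a 1) = digamma a := by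
  have hΓ := Real.Gamma_pos_of_pos ha
  rw [digamma, ((integrableOn_log_mul_and_hasDerivAt_Gamma ha).2.log hΓ.ne').deriv,
    gammaMeas_eq_withDensity_restrict,
    integral_withDensity_eq_integral_toReal_smul (by fun_prop) (by simp), ← integral_div]
  refine setIntegral_congr_fun measurableSet_Ioi fun t ht => ?_
  have ht' : 0 < t := ht
  rw [ENNReal.toReal_ofReal (by positivity), Real.one_rpow, smul_eq_mul]
  ring_nf

/-- The map recovering two scaled Gamma variables from their total and their proportion. -/
noncomputable def totalProportion (b₁ b₂ : ℝ) (q : ℝ × ℝ) : ℝ × ℝ :=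
  (q.1 * q.2 / b₁, q.1 * (1 - q.2) / b₂)

/-- The derivative of `totalProportion`, see `hasFDerivAt_totalProportion`. -/
noncomputable def fderivTotalProportion (b₁ b₂ : ℝ) (q : ℝ × ℝ) : ℝ × ℝ →L[ℝ] ℝ × ℝ :=
  (Matrix.toLin (.finTwoProd ℝ) (.finTwoProd ℝ)
    !![q.2 / b₁, q.1 / b₁; (1 - q.2) / b₂, -q.1 / b₂]).toContinuousLinearMap

theorem hasFDerivAt_totalProportion (b₁ b₂ : ℝ) (q : ℝ × ℝ) :
    HasFDerivAt (totalProportion b₁ b₂) (fderivTotalProportion b₁ b₂ q) q := by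
  unfold fderivTotalProportion
  rw [Matrix.toLin_finTwoProd_toContinuousLinearMap]
  have h₁ : HasFDerivAt (fun q : ℝ × ℝ => q.1 * q.2 / b₁) _ q :=
    ((hasFDerivAt_fst (𝕜 := ℝ)).mul (hasFDerivAt_snd (𝕜 := ℝ))).mul_const b₁⁻¹
  have h₂ : HasFDerivAt (fun q : ℝ × ℝ => q.1 * (1 - q.2) / b₂) _ q :=
    ((hasFDerivAt_fst (𝕜 := ℝ)).mul ((hasFDerivAt_snd (𝕜 := ℝ)).const_sub 1)).mul_const b₂⁻¹
  convert! h₁.prodMk h₂ using 1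
  ext <;> simp <;> ring

theorem det_fderivTotalProportion (b₁ b₂ : ℝ) (q : ℝ × ℝ) :
    (fderivTotalProportion b₁ b₂ q).det = -(q.1 / (b₁ * b₂)) := by
  unfold fderivTotalProportion
  simp only [LinearMap.det_toContinuousLinearMap, LinearMap.det_toLin, Matrix.det_fin_two_of]
  ring

theorem injOn_totalProportion {b₁ b₂ : ℝ} (hb₁ : 0 < b₁) (hb₂ : 0 < b₂) :
    InjOn (totalProportion b₁ b₂) (Ioi 0 ×ˢ Ioo 0 1) := by
  rintro ⟨s, x⟩ ⟨hs, -⟩ ⟨t, y⟩ - h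
  simp only [totalProportion, Prod.mk.injEq, div_left_inj' hb₁.ne', div_left_inj' hb₂.ne'] at h
  obtain ⟨h₁, h₂⟩ := h
  have hst : s = t := by linarith
  subst hst
  have hs' : s ≠ 0 := ne_of_gt hs
  rw [mul_left_cancel₀ hs' h₁]

theorem image_totalProportion {b₁ b₂ : ℝ} (hb₁ : 0 < b₁) (hb₂ : 0 < b₂) :
    totalProportion b₁ b₂ '' (Ioi 0 ×ˢ Ioo 0 1) = Ioi 0 ×ˢ Ioi 0 := by
  ext ⟨u, v⟩
  constructor
  · rintro ⟨⟨s, x⟩, ⟨hs, hx₀, hx₁⟩, h⟩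
    simp only [mem_Ioi] at hs hx₀ hx₁
    rw [← h]
    have := sub_pos.2 hx₁
    simp only [totalProportion, mem_prod, mem_Ioi]
    constructor <;> positivity
  · rintro ⟨hu, hv⟩
    simp only [mem_Ioi] at hu hv
    have hpos : 0 < b₁ * u + b₂ * v := by positivity
    refine ⟨(b₁ * u + b₂ * v, b₁ * u / (b₁ * u + b₂ * v)), ⟨hpos, by positivity, ?_⟩, ?_⟩
    · simp only
      rw [div_lt_one hpos]
      have : 0 < b₂ * v := by positivity
      linarith
    · simp only [totalProportion, Prod.mk.injEq]
      constructor <;> field_simp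
      ring

theorem gammaDensity_mul_totalProportion {a₁ a₂ b₁ b₂ s x : ℝ} (ha₁ : 0 < a₁) (ha₂ : 0 < a₂)
    (hb₁ : 0 < b₁) (hb₂ : 0 < b₂) (hs : 0 < s) (hx₀ : 0 < x) (hx₁ : x < 1) :
    s / (b₁ * b₂) *
      ((b₁ ^ a₁ * (s * x / b₁) ^ (a₁ - 1) * Real.exp (-b₁ * (s * x / b₁)) / Real.Gamma a₁) *
      (b₂ ^ a₂ * (s * (1 - x) / b₂) ^ (a₂ - 1) * Real.exp (-b₂ * (s * (1 - x) / b₂)) /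
        Real.Gamma a₂)) =
    (1 ^ (a₁ + a₂) * s ^ (a₁ + a₂ - 1) * Real.exp (-1 * s) / Real.Gamma (a₁ + a₂)) *
      (1 / beta a₁ a₂ * x ^ (a₁ - 1) * (1 - x) ^ (a₂ - 1)) := by
  have hy : 0 < 1 - x := sub_pos.2 hx₁
  have hΓ₁ := (Real.Gamma_pos_of_pos ha₁).ne'
  have hΓ₂ := (Real.Gamma_pos_of_pos ha₂).ne'
  have hΓ := (Real.Gamma_pos_of_pos (add_pos ha₁ ha₂)).ne'
  have hexp : Real.exp (-1 * s) =
      Real.exp (-b₁ * (s * x / b₁)) * Real.exp (-b₂ * (s * (1 - x) / b₂)) := by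
    rw [← Real.exp_add]
    congr 1
    field_simp
    ring
  have hspow : s ^ (a₁ + a₂ - 1) = s * (s ^ (a₁ - 1) * s ^ (a₂ - 1)) := by
    rw [← Real.rpow_add hs, mul_comm, ← Real.rpow_add_one hs.ne']
    ring_nf
  have hb₁pow : b₁ ^ a₁ = b₁ ^ (a₁ - 1) * b₁ := by
    rw [← Real.rpow_add_one hb₁.ne', sub_add_cancel]
  have hb₂pow : b₂ ^ a₂ = b₂ ^ (a₂ - 1) * b₂ := by
    rw [← Real.rpow_add_one hb₂.ne', sub_add_cancel]
  have := (Real.rpow_pos_of_pos hb₁ (a₁ - 1)).ne'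
  have := (Real.rpow_pos_of_pos hb₂ (a₂ - 1)).ne'
  rw [hexp, hspow, hb₁pow, hb₂pow, Real.one_rpow, beta,
    Real.div_rpow (by positivity) hb₁.le, Real.div_rpow (by positivity) hb₂.le,
    Real.mul_rpow hs.le hx₀.le, Real.mul_rpow hs.le hy.le]
  generalize Real.exp (-b₁ * (s * x / b₁)) = e₁
  generalize Real.exp (-b₂ * (s * (1 - x) / b₂)) = e₂
  generalize b₁ ^ (a₁ - 1) = p₁ at *
  generalize b₂ ^ (a₂ - 1) = p₂ at *
  field_simp

/-- The total and the proportion of two independent Gamma variables (after rescaling both to rate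
`1`) are independent, with a Gamma and a Beta distribution respectively. -/
theorem gammaMeas_prod_eq_map {a₁ a₂ b₁ b₂ : ℝ} (ha₁ : 0 < a₁) (ha₂ : 0 < a₂)
    (hb₁ : 0 < b₁) (hb₂ : 0 < b₂) :
    (gammaMeas a₁ b₁).prod (gammaMeas a₂ b₂) =
      ((gammaMeas (a₁ + a₂) 1).prod (betaMeasure a₁ a₂)).map (totalProportion b₁ b₂) := by
  have hmeas : Measurable (totalProportion b₁ b₂) := by
    unfold totalProportion
    fun_prop
  refine Measure.ext_of_lintegral _ fun F hF => ?_
  rw [lintegral_map hF hmeas]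
  simp only [gammaMeas_eq_withDensity_restrict, betaMeasure_eq_withDensity_restrict]
  rw [prod_withDensity (by fun_prop) (by fun_prop), prod_withDensity (by fun_prop) (by fun_prop),
    Measure.prod_restrict, Measure.prod_restrict,
    lintegral_withDensity_eq_lintegral_mul _ (by fun_prop) hF,
    lintegral_withDensity_eq_lintegral_mul _ (by fun_prop)
      (show Measurable fun q => F (totalProportion b₁ b₂ q) from hF.comp hmeas),
    ← Measure.volume_eq_prod, ← image_totalProportion hb₁ hb₂,
    lintegral_image_eq_lintegral_abs_det_fderiv_mul volume
      (measurableSet_Ioi.prod measurableSet_Ioo)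
      (fun q _ => (hasFDerivAt_totalProportion b₁ b₂ q).hasFDerivWithinAt)
      (injOn_totalProportion hb₁ hb₂)]
  refine setLIntegral_congr_fun (measurableSet_Ioi.prod measurableSet_Ioo) ?_
  rintro ⟨s, x⟩ ⟨hs, hx₀, hx₁⟩
  simp only [mem_Ioi] at hs hx₀ hx₁
  have hy : 0 < 1 - x := sub_pos.2 hx₁
  have hΓ₁ := Real.Gamma_pos_of_pos ha₁
  have hΓ₂ := Real.Gamma_pos_of_pos ha₂
  have hΓ := Real.Gamma_pos_of_pos (add_pos ha₁ ha₂)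
  simp only [det_fderivTotalProportion, abs_neg, Pi.mul_apply]
  rw [← mul_assoc]
  congr 1
  rw [abs_of_pos (by positivity), ← ENNReal.ofReal_mul (by simp only [totalProportion]; positivity),
    ← ENNReal.ofReal_mul (by positivity), ← ENNReal.ofReal_mul (by positivity)]
  exact congrArg _ (gammaDensity_mul_totalProportion ha₁ ha₂ hb₁ hb₂ hs hx₀ hx₁)

theorem one_sub_mul_mem_Icc {c x : ℝ} (hx : x ∈ Icc (0 : ℝ) 1) :
    1 - (1 - c) * x ∈ Icc (min c 1) (max c 1) := by
  obtain ⟨hx₀, hx₁⟩ := hx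
  constructor
  · nlinarith [min_le_left c 1, min_le_right c 1]
  · nlinarith [le_max_left c 1, le_max_right c 1]

theorem ae_betaMeasure_mem_Ioo (a b : ℝ) : ∀ᵐ x ∂(betaMeasure a b), x ∈ Ioo (0 : ℝ) 1 := by
  rw [betaMeasure_eq_withDensity_restrict]
  exact (withDensity_absolutelyContinuous _ _).ae_le (ae_restrict_mem measurableSet_Ioo)

theorem ae_gammaMeas_pos (a b : ℝ) : ∀ᵐ x ∂(gammaMeas a b), 0 < x := by
  rw [gammaMeas_eq_withDensity_restrict]
  exact (withDensity_absolutelyContinuous _ _).ae_le (ae_restrict_mem measurableSet_Ioi)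

theorem integrable_log_one_sub_mul_betaMeasure {a b c : ℝ} (ha : 0 < a) (hb : 0 < b)
    (hc : 0 < c) :
    Integrable (fun x => Real.log (1 - (1 - c) * x)) (betaMeasure a b) := by
  have := isProbabilityMeasureBeta ha hb
  refine Integrable.of_mem_Icc (Real.log (min c 1)) (Real.log (max c 1)) (by fun_prop) ?_
  filter_upwards [ae_betaMeasure_mem_Ioo a b] with x hx
  have hmem := one_sub_mul_mem_Icc (c := c) (Ioo_subset_Icc_self hx)
  have hmin : 0 < min c 1 := lt_min hc one_pos
  exact ⟨Real.log_le_log hmin hmem.1, Real.log_le_log (hmin.trans_le hmem.1) hmem.2⟩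

theorem integral_betaMeasure {a b : ℝ} (ha : 0 < a) (hb : 0 < b) (f : ℝ → ℝ) :
    ∫ x, f x ∂(betaMeasure a b) =
      Real.Gamma (a + b) / (Real.Gamma a * Real.Gamma b) *
        ∫ x in (0 : ℝ)..1, x ^ (a - 1) * (1 - x) ^ (b - 1) * f x := by
  rw [betaMeasure_eq_withDensity_restrict,
    integral_withDensity_eq_integral_toReal_smul (by fun_prop) (by simp),
    intervalIntegral.integral_of_le zero_le_one, integral_Ioc_eq_integral_Ioo,
    ← integral_const_mul]
  refine setIntegral_congr_fun measurableSet_Ioo fun x hx => ?_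
  have hβ := beta_pos ha hb
  have hx₀ : 0 < x := hx.1
  have hy : 0 < 1 - x := sub_pos.2 hx.2
  rw [ENNReal.toReal_ofReal (by positivity), smul_eq_mul, beta, one_div_div]
  ring

theorem log_add_totalProportion {b₁ b₂ s x : ℝ} (hb₁ : 0 < b₁) (hb₂ : 0 < b₂) (hs : 0 < s)
    (hx : x ∈ Icc (0 : ℝ) 1) :
    Real.log ((totalProportion b₁ b₂ (s, x)).1 + (totalProportion b₁ b₂ (s, x)).2) =
      Real.log s - Real.log b₂ + Real.log (1 - (1 - b₂ / b₁) * x) := by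
  have hpos : 0 < 1 - (1 - b₂ / b₁) * x :=
    (lt_min (div_pos hb₂ hb₁) one_pos).trans_le (one_sub_mul_mem_Icc hx).1
  rw [← Real.log_div hs.ne' hb₂.ne', ← Real.log_mul (div_pos hs hb₂).ne' hpos.ne']
  congr 1
  simp only [totalProportion]
  field_simp
  ring

theorem integrable_and_integral_log_add_gammaMeas {a₁ a₂ b₁ b₂ : ℝ} (ha₁ : 0 < a₁) (ha₂ : 0 < a₂)
    (hb₁ : 0 < b₁) (hb₂ : 0 < b₂) :
    Integrable (fun p : ℝ × ℝ => Real.log (p.1 + p.2))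
      ((gammaMeas a₁ b₁).prod (gammaMeas a₂ b₂)) ∧
    ∫ p : ℝ × ℝ, Real.log (p.1 + p.2) ∂((gammaMeas a₁ b₁).prod (gammaMeas a₂ b₂)) =
      digamma (a₁ + a₂) - Real.log b₂ +
        Real.Gamma (a₁ + a₂) / (Real.Gamma a₁ * Real.Gamma a₂) *
          ∫ x in (0 : ℝ)..1,
            x ^ (a₁ - 1) * (1 - x) ^ (a₂ - 1) * Real.log (1 - (1 - b₂ / b₁) * x) := by
  have ha := add_pos ha₁ ha₂
  have := isProbabilityMeasure_gammaMeas ha one_pos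
  have := isProbabilityMeasureBeta ha₁ ha₂
  have hmeas : Measurable (totalProportion b₁ b₂) := by
    unfold totalProportion
    fun_prop
  have hlog : Measurable fun p : ℝ × ℝ => Real.log (p.1 + p.2) := by fun_prop
  have hS := integrable_log_gammaMeas ha
  have hX := integrable_log_one_sub_mul_betaMeasure ha₁ ha₂ (div_pos hb₂ hb₁)
  have hS' : Integrable (fun q : ℝ × ℝ => Real.log q.1 - Real.log b₂)
      ((gammaMeas (a₁ + a₂) 1).prod (betaMeasure a₁ a₂)) :=
    (hS.sub (integrable_const (Real.log b₂))).comp_fst _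
  have hX' : Integrable (fun q : ℝ × ℝ => Real.log (1 - (1 - b₂ / b₁) * q.2))
      ((gammaMeas (a₁ + a₂) 1).prod (betaMeasure a₁ a₂)) := hX.comp_snd _
  have hae : (fun q => Real.log ((totalProportion b₁ b₂ q).1 + (totalProportion b₁ b₂ q).2))
      =ᵐ[(gammaMeas (a₁ + a₂) 1).prod (betaMeasure a₁ a₂)]
      fun q => Real.log q.1 - Real.log b₂ + Real.log (1 - (1 - b₂ / b₁) * q.2) := by
    filter_upwards [Measure.quasiMeasurePreserving_fst.ae (ae_gammaMeas_pos (a₁ + a₂) 1),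
      Measure.quasiMeasurePreserving_snd.ae (ae_betaMeasure_mem_Ioo a₁ a₂)] with q hq₁ hq₂
    exact log_add_totalProportion hb₁ hb₂ hq₁ (Ioo_subset_Icc_self hq₂)
  rw [gammaMeas_prod_eq_map ha₁ ha₂ hb₁ hb₂,
    integrable_map_measure hlog.aestronglyMeasurable hmeas.aemeasurable,
    integral_map hmeas.aemeasurable hlog.aestronglyMeasurable]
  refine ⟨(hS'.add hX').congr hae.symm, ?_⟩
  rw [integral_congr_ae hae, integral_add hS' hX',
    integral_fun_fst (fun s => Real.log s - Real.log b₂),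
    integral_fun_snd (fun x => Real.log (1 - (1 - b₂ / b₁) * x)),
    integral_sub hS (integrable_const _), integral_log_gammaMeas ha, integral_betaMeasure ha₁ ha₂]
  simp

theorem statement14 (β N₀ N : ℕ) (hβ : β = 1 ∨ β = 2 ∨ β = 4)
    (hN₀ : 1 ≤ N₀) (hN : N₀ < N) (b₁ b₂ : ℝ) (hb₂ : 0 < b₂) (hb : b₂ ≤ b₁) :
    Integrable (fun p : ℝ × ℝ => Real.log (p.1 + p.2))
      ((gammaMeas ((β : ℝ) * N₀ / 2) b₁).prod
        (gammaMeas ((β : ℝ) * ((N : ℝ) - N₀) / 2) b₂)) ∧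
    ∫ p : ℝ × ℝ, Real.log (p.1 + p.2)
        ∂((gammaMeas ((β : ℝ) * N₀ / 2) b₁).prod
          (gammaMeas ((β : ℝ) * ((N : ℝ) - N₀) / 2) b₂)) =
      digamma ((β : ℝ) * N / 2) - Real.log b₂ +
        (Real.Gamma ((β : ℝ) * N / 2) /
            (Real.Gamma ((β : ℝ) * N₀ / 2) * Real.Gamma ((β : ℝ) * ((N : ℝ) - N₀) / 2))) *
          ∫ x in (0 : ℝ)..1,
            x ^ ((β : ℝ) * N₀ / 2 - 1) * (1 - x) ^ ((β : ℝ) * ((N : ℝ) - N₀) / 2 - 1) *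
              Real.log (1 - (1 - b₂ / b₁) * x) := by
  have hβ₀ : (0 : ℝ) < β := by
    rcases hβ with rfl | rfl | rfl <;> norm_num
  have hN₀' : (0 : ℝ) < N₀ := by exact_mod_cast hN₀
  have hN' : (0 : ℝ) < (N : ℝ) - N₀ := sub_pos.2 (by exact_mod_cast hN)
  have hsum : (β : ℝ) * N / 2 = (β : ℝ) * N₀ / 2 + (β : ℝ) * ((N : ℝ) - N₀) / 2 := by ring
  rw [hsum]
  exact integrable_and_integral_log_add_gammaMeas (by positivity) (by positivity)
    (hb₂.trans_le hb) hb₂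
end

section
/- Let N and β be positive integers and let b_1, …, b_N > 0. Let (x_{l,s})_{1≤l≤N, 1≤s≤β} be independent real random variables, where x_{l,s} is normally distributed with mean 0 and variance 1/(2 b_l). Then E[ log( Σ_{l=1}^N Σ_{s=1}^β x_{l,s}² ) ] is finite and equals ∫₀^∞ ( e^{−t} − ∏_{l=1}^N (1 + t/b_l)^{−β/2} ) dt/t. (Twice the largest Lyapunov exponent of a product of i.i.d. isotropic Gaussian random matrices with row variances 1/(2b_l) equals this integral.) -/
open MeasureTheory Real

/-- The normal distribution with mean `0` and variance `v`: the measure on `ℝ` with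
density `(2πv)^{-1/2} exp(-x²/(2v))` with respect to Lebesgue measure. -/
noncomputable def normalMeas (v : ℝ) : Measure ℝ :=
  volume.withDensity fun x =>
    ENNReal.ofReal ((2 * π * v) ^ (-(1 : ℝ) / 2) * Real.exp (-(x ^ 2) / (2 * v)))

open ProbabilityTheory Set

lemma normalMeas_eq_gaussianReal {v : ℝ} (hv : 0 < v) :
    normalMeas v = gaussianReal 0 v.toNNReal := by
  have hv' : v.toNNReal ≠ 0 := by simpa using hv
  rw [gaussianReal_of_var_ne_zero _ hv', normalMeas]
  congr 1
  ext1 x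
  rw [gaussianPDF, gaussianPDFReal, Real.coe_toNNReal v hv.le, sub_zero, Real.sqrt_eq_rpow,
    ← Real.rpow_neg (by positivity)]
  norm_num

/-- The Laplace transform of the square of a centred Gaussian variable. -/
lemma integral_exp_neg_mul_sq_gaussianReal {b t : ℝ} (hb : 0 < b) (ht : 0 ≤ t) :
    ∫ x, exp (-(t * x ^ 2)) ∂gaussianReal 0 (1 / (2 * b)).toNNReal =
      (1 + t / b) ^ (-(1 : ℝ) / 2) := by
  have hv : 0 < 1 / (2 * b) := by positivity
  have hv' : (1 / (2 * b)).toNNReal ≠ 0 := by simpa using hb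
  rw [integral_gaussianReal_eq_integral_smul hv']
  simp only [gaussianPDFReal, Real.coe_toNNReal _ hv.le, sub_zero, smul_eq_mul, mul_assoc,
    ← Real.exp_add]
  have h (x : ℝ) : -x ^ 2 / (2 * (1 / (2 * b))) + -(t * x ^ 2) = -(b + t) * x ^ 2 := by
    field_simp
    ring
  simp only [h]
  rw [integral_const_mul, integral_gaussian, neg_div, Real.rpow_neg (by positivity),
    ← Real.sqrt_eq_rpow, ← Real.sqrt_inv, ← Real.sqrt_inv, ← Real.sqrt_mul (by positivity)]
  congr 1
  have := Real.pi_pos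
  field_simp

lemma integrable_sq_gaussianReal (μ : ℝ) (v : NNReal) :
    Integrable (fun x => x ^ 2) (gaussianReal μ v) :=
  (memLp_id_gaussianReal 2).integrable_sq

lemma gaussianReal_le_smul_volume (μ : ℝ) {v : NNReal} (hv : v ≠ 0) :
    gaussianReal μ v ≤ ENNReal.ofReal (√(2 * π * v))⁻¹ • volume := by
  rw [gaussianReal_of_var_ne_zero _ hv, ← withDensity_const]
  refine withDensity_mono (ae_of_all _ fun x => ENNReal.ofReal_le_ofReal ?_)
  refine mul_le_of_le_one_right (by positivity) (Real.exp_le_one_iff.2 ?_)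
  exact div_nonpos_of_nonpos_of_nonneg (by simpa using sq_nonneg _) (by positivity)

lemma integrable_log_sq_gaussianReal (μ : ℝ) {v : NNReal} (hv : v ≠ 0) :
    Integrable (fun x => log (x ^ 2)) (gaussianReal μ v) := by
  have hlog : Integrable (indicator (Ioc (-1) 1) log) (gaussianReal μ v) := by
    refine Integrable.mono_measure ?_ (gaussianReal_le_smul_volume μ hv)
    refine Integrable.smul_measure ?_ ENNReal.ofReal_ne_top
    rw [integrable_indicator_iff measurableSet_Ioc]
    exact (intervalIntegral.intervalIntegrable_log' (a := -1) (b := 1)).1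
  refine ((hlog.norm.const_mul 2).add (integrable_sq_gaussianReal μ v)).mono'
    (Measurable.aestronglyMeasurable (by fun_prop)) (ae_of_all _ fun x => ?_)
  simp only [Pi.add_apply, Real.norm_eq_abs]
  by_cases hx : x ∈ Ioc (-1 : ℝ) 1
  · rw [indicator_of_mem hx, Real.log_pow, abs_mul]
    simpa using sq_nonneg x
  · rw [indicator_of_notMem hx]
    have hx1 : 1 ≤ x ^ 2 := by
      simp only [mem_Ioc, not_and_or, not_lt, not_le] at hx
      rcases hx with hx | hx <;> nlinarith
    rw [abs_of_nonneg (Real.log_nonneg hx1)]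
    simpa using Real.log_le_self (sq_nonneg x)

lemma abs_exp_neg_sub_exp_neg_le (x y : ℝ) :
    |exp (-x) - exp (-y)| ≤ exp (-min x y) * |x - y| := by
  wlog h : x ≤ y generalizing x y
  · rw [abs_sub_comm, abs_sub_comm x, min_comm]
    exact this y x (le_of_not_ge h)
  rw [min_eq_left h, abs_of_nonneg (by simpa using h), abs_of_nonpos (by linarith)]
  have h1 : exp (-y) = exp (-x) * exp (x - y) := by rw [← Real.exp_add]; ring_nf
  have h2 := Real.add_one_le_exp (x - y)
  rw [h1]
  nlinarith [Real.exp_pos (-x)]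

lemma integrableOn_frullani_exp {s : ℝ} (hs : 0 < s) :
    IntegrableOn (fun t => (exp (-t) - exp (-(t * s))) / t) (Ioi 0) := by
  have hm : 0 < min 1 s := lt_min one_pos hs
  refine Integrable.mono' ((integrableOn_exp_mul_Ioi (neg_lt_zero.2 hm) 0).mul_const |1 - s|)
    (Measurable.aestronglyMeasurable (by fun_prop))
    (ae_restrict_of_forall_mem measurableSet_Ioi fun t ht => ?_)
  rw [mem_Ioi] at ht
  rw [norm_div, Real.norm_eq_abs, Real.norm_eq_abs, abs_of_pos ht, div_le_iff₀ ht]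
  refine (abs_exp_neg_sub_exp_neg_le t (t * s)).trans_eq ?_
  have h1 : min t (t * s) = min 1 s * t := by
    rw [min_mul_of_nonneg _ _ ht.le, one_mul, mul_comm]
  have h2 : |t - t * s| = |1 - s| * t := by
    rw [← mul_one_sub, abs_mul, abs_of_pos ht, mul_comm]
  rw [h1, h2, neg_mul, mul_assoc]

lemma integral_frullani_exp {s : ℝ} (hs : 0 < s) :
    ∫ t in Ioi 0, (exp (-t) - exp (-(t * s))) / t = log s := by
  have h := Frullani.integral_Ioi_eq (f := fun x : ℝ => exp (-x)) (a := 1) (b := s) (L := 1)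
    (R := 0) (Continuous.locallyIntegrable (by fun_prop) |>.locallyIntegrableOn _) one_pos hs
    ((Continuous.tendsto' (by fun_prop) _ _ (by simp)).mono_left nhdsWithin_le_nhds)
    Real.tendsto_exp_neg_atTop_nhds_zero
    ((integrableOn_frullani_exp hs).congr_fun (fun t _ => by
      simp [div_eq_inv_mul, mul_comm]) measurableSet_Ioi)
  simpa [div_eq_inv_mul, mul_comm] using h

lemma integral_abs_frullani_exp {s : ℝ} (hs : 0 < s) :
    ∫ t in Ioi 0, ‖(exp (-t) - exp (-(t * s))) / t‖ = |log s| := by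
  rw [← integral_frullani_exp hs]
  rcases le_total 1 s with h | h
  · have hnn (t : ℝ) (ht : t ∈ Ioi 0) : 0 ≤ (exp (-t) - exp (-(t * s))) / t := by
      rw [mem_Ioi] at ht
      refine div_nonneg (sub_nonneg.2 (Real.exp_le_exp.2 ?_)) ht.le
      nlinarith
    rw [abs_of_nonneg (setIntegral_nonneg measurableSet_Ioi hnn)]
    exact setIntegral_congr_fun measurableSet_Ioi fun t ht => Real.norm_of_nonneg (hnn t ht)
  · have hnp (t : ℝ) (ht : t ∈ Ioi 0) : (exp (-t) - exp (-(t * s))) / t ≤ 0 := by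
      rw [mem_Ioi] at ht
      refine div_nonpos_of_nonpos_of_nonneg (sub_nonpos.2 (Real.exp_le_exp.2 ?_)) ht.le
      nlinarith
    rw [abs_of_nonpos (setIntegral_nonpos measurableSet_Ioi hnp), ← integral_neg]
    exact setIntegral_congr_fun measurableSet_Ioi fun t ht => Real.norm_of_nonpos (hnp t ht)

/-- The expected logarithm of a positive random variable in terms of its Laplace transform. -/
lemma integral_log_eq_integral_laplace {Ω : Type*} [MeasurableSpace Ω] {P : Measure Ω}
    [IsProbabilityMeasure P] {S : Ω → ℝ} (hS : Measurable S) (hpos : ∀ᵐ ω ∂P, 0 < S ω)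
    (hlog : Integrable (fun ω => log (S ω)) P) :
    ∫ ω, log (S ω) ∂P =
      ∫ t in Ioi 0, (exp (-t) - ∫ ω, exp (-(t * S ω)) ∂P) / t := by
  have hint : Integrable (Function.uncurry fun ω t => (exp (-t) - exp (-(t * S ω))) / t)
      (P.prod (volume.restrict (Ioi 0))) := by
    rw [integrable_prod_iff (Measurable.aestronglyMeasurable (by
      unfold Function.uncurry; fun_prop))]
    refine ⟨hpos.mono fun ω h => integrableOn_frullani_exp h, hlog.norm.congr ?_⟩
    exact hpos.mono fun ω h => (integral_abs_frullani_exp h).symm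
  calc ∫ ω, log (S ω) ∂P
    _ = ∫ ω, (∫ t in Ioi 0, (exp (-t) - exp (-(t * S ω))) / t) ∂P :=
      integral_congr_ae (hpos.mono fun ω h => (integral_frullani_exp h).symm)
    _ = ∫ t in Ioi 0, ∫ ω, (exp (-t) - exp (-(t * S ω))) / t ∂P := integral_integral_swap hint
    _ = _ := by
      refine setIntegral_congr_fun measurableSet_Ioi fun t ht => ?_
      have hexp : Integrable (fun ω => exp (-(t * S ω))) P := by
        refine Integrable.of_bound (by fun_prop) 1 (hpos.mono fun ω h => ?_)
        rw [Real.norm_of_nonneg (Real.exp_pos _).le, Real.exp_le_one_iff]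
        exact neg_nonpos.2 (mul_nonneg (le_of_lt ht) h.le)
      rw [integral_div, integral_sub (integrable_const _) hexp]
      simp

section GaussianVector

variable {ι : Type*} [Fintype ι] (v : ι → NNReal)

lemma ae_eval_ne_zero_pi_gaussianReal {i : ι} (hi : v i ≠ 0) :
    ∀ᵐ x ∂Measure.pi fun p => gaussianReal 0 (v p), x i ≠ 0 := by
  have := nullSingletonClass_gaussianReal (μ := 0) hi
  have hne : ∀ᵐ y ∂gaussianReal 0 (v i), y ≠ 0 := by simp [ae_iff]
  exact (measurePreserving_eval (fun p => gaussianReal 0 (v p)) i).quasiMeasurePreserving.ae hne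

lemma ae_sum_sq_pos_pi_gaussianReal {i : ι} (hi : v i ≠ 0) :
    ∀ᵐ x ∂Measure.pi fun p => gaussianReal 0 (v p), 0 < ∑ p, x p ^ 2 := by
  filter_upwards [ae_eval_ne_zero_pi_gaussianReal v hi] with x hx
  exact Finset.sum_pos' (fun p _ => sq_nonneg _) ⟨i, Finset.mem_univ i, by positivity⟩

lemma integrable_log_sum_sq_pi_gaussianReal {i : ι} (hi : v i ≠ 0) :
    Integrable (fun x => log (∑ p, x p ^ 2)) (Measure.pi fun p => gaussianReal 0 (v p)) := by
  have hsum : Integrable (fun x : ι → ℝ => ∑ p, x p ^ 2)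
      (Measure.pi fun p => gaussianReal 0 (v p)) :=
    integrable_finsetSum _ fun p _ => integrable_comp_eval (μ := fun p => gaussianReal 0 (v p))
      (integrable_sq_gaussianReal 0 (v p))
  have hlog := integrable_comp_eval (μ := fun p => gaussianReal 0 (v p))
    (integrable_log_sq_gaussianReal 0 hi)
  refine (hsum.add hlog.norm).mono' (Measurable.aestronglyMeasurable (by fun_prop)) ?_
  filter_upwards [ae_eval_ne_zero_pi_gaussianReal v hi] with x hx
  have hxi : 0 < x i ^ 2 := by positivity
  have hle : x i ^ 2 ≤ ∑ p, x p ^ 2 :=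
    Finset.single_le_sum (f := fun p => x p ^ 2) (fun p _ => sq_nonneg _) (Finset.mem_univ i)
  simp only [Pi.add_apply, Real.norm_eq_abs]
  have h1 := Real.log_le_log hxi hle
  have h2 := Real.log_le_self (hxi.le.trans hle)
  have h3 := neg_abs_le (log (x i ^ 2))
  have h4 := abs_nonneg (log (x i ^ 2))
  exact abs_le.2 ⟨by linarith, by linarith⟩

end GaussianVector

theorem statement15 (N β : ℕ) (hN : 0 < N) (hβ : 0 < β)
    (b : Fin N → ℝ) (hb : ∀ l, 0 < b l) :
    Integrable (fun x : Fin N × Fin β → ℝ => Real.log (∑ p, x p ^ 2))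
      (Measure.pi fun p : Fin N × Fin β => normalMeas (1 / (2 * b p.1))) ∧
    ∫ x : Fin N × Fin β → ℝ, Real.log (∑ p, x p ^ 2)
        ∂(Measure.pi fun p : Fin N × Fin β => normalMeas (1 / (2 * b p.1))) =
      ∫ t in Set.Ioi (0 : ℝ),
        (Real.exp (-t) - ∏ l, (1 + t / b l) ^ (-(β : ℝ) / 2)) / t := by
  have hmeas (p : Fin N × Fin β) : normalMeas (1 / (2 * b p.1)) =
      gaussianReal 0 (1 / (2 * b p.1)).toNNReal :=
    normalMeas_eq_gaussianReal (by have := hb p.1; positivity)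
  simp only [hmeas]
  let v : Fin N × Fin β → NNReal := fun p => (1 / (2 * b p.1)).toNNReal
  have hv : v (⟨0, hN⟩, ⟨0, hβ⟩) ≠ 0 := by simpa [v] using hb _
  have hint := integrable_log_sum_sq_pi_gaussianReal v hv
  refine ⟨hint, ?_⟩
  rw [integral_log_eq_integral_laplace (by fun_prop) (ae_sum_sq_pos_pi_gaussianReal v hv) hint]
  refine setIntegral_congr_fun measurableSet_Ioi fun t ht => ?_
  rw [mem_Ioi] at ht
  simp only [Finset.mul_sum, ← Finset.sum_neg_distrib, Real.exp_sum]
  rw [integral_fintype_prod_eq_prod (fun _ y => exp (-(t * y ^ 2)))]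
  simp only [v, integral_exp_neg_mul_sq_gaussianReal (hb _) ht.le, Fintype.prod_prod_type,
    Finset.prod_const, Finset.card_univ, Fintype.card_fin]
  congr 3 with l
  have := hb l
  rw [← Real.rpow_mul_natCast (by positivity)]
  congr 1
  ring
end

section
/- Let β and N be positive integers and let ω_1, …, ω_N > 0. Let y_1, …, y_N be independent random vectors in ℝ^β, where y_l has density (Γ((ω_l+β)/2)/(π^{β/2} Γ(ω_l/2))) (1 + |y|²)^{−(ω_l+β)/2} on ℝ^β. Then E[ log( Σ_{l=1}^N |y_l|² ) ] is finite and equals ∫₀^∞ ( e^{−t} − ∏_{l=1}^N (Γ((ω_l+β)/2)/Γ(ω_l/2)) U(β/2, 1−ω_l/2; t) ) dt/t, where U is the confluent hypergeometric function of the second kind. (Twice the largest Lyapunov exponent of a product of i.i.d. random matrices with independent isotropic beta type II rows equals this integral.) -/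
open MeasureTheory Real

/-- The confluent hypergeometric function of the second kind, via the integral
representation `U(a,b;t) = (1/Γ(a)) ∫₀^∞ e^{-ts} s^{a-1} (1+s)^{b-a-1} ds`. -/
noncomputable def hypU (a b t : ℝ) : ℝ :=
  (1 / Real.Gamma a) *
    ∫ s in Set.Ioi (0 : ℝ), Real.exp (-t * s) * s ^ (a - 1) * (1 + s) ^ (b - a - 1)

/-- The distribution on `ℝ^β` of a vector with beta type II density
`(Γ((ω+β)/2)/(π^{β/2} Γ(ω/2))) (1+|y|²)^{-(ω+β)/2}` on `ℝ^β`. -/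
noncomputable def betaIIVecMeasure (β : ℕ) (ω : ℝ) : Measure (Fin β → ℝ) :=
  volume.withDensity fun y =>
    ENNReal.ofReal ((Real.Gamma ((ω + (β : ℝ)) / 2) / (π ^ ((β : ℝ) / 2) * Real.Gamma (ω / 2))) *
      (1 + ∑ s, y s ^ 2) ^ (-(ω + (β : ℝ)) / 2))

/-- Beta integral over the half-line. -/
lemma integral_rpow_mul_one_add_rpow_neg {p q : ℝ} (hp : 0 < p) (hq : 0 < q) :
    ∫ s in Set.Ioi (0 : ℝ), s ^ (p - 1) * (1 + s) ^ (-(p + q)) =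
      Gamma p * Gamma q / Gamma (p + q) := by
  have hpq : 0 < p + q := add_pos hp hq
  let f : ℝ → ℝ → ℝ := fun s x => s ^ (p - 1) * (x ^ (p + q - 1) * exp (-((1 + s) * x)))
  have h_left : ∀ x ∈ Set.Ioi (0 : ℝ),
      ∫ s in Set.Ioi (0 : ℝ), f s x = Gamma p * (exp (-x) * x ^ (q - 1)) := by
    intro x hx
    have hx : 0 < x := hx
    have h : ∀ s, f s x = (x ^ (p + q - 1) * exp (-x)) * (s ^ (p - 1) * exp (-(x * s))) := by
      intro s
      simp only [f]
      rw [show -((1 + s) * x) = -x + -(x * s) by ring, exp_add]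
      ring
    simp_rw [h]
    rw [integral_const_mul, integral_rpow_mul_exp_neg_mul_Ioi hp hx, one_div,
      inv_rpow hx.le, ← rpow_neg hx.le, show p + q - 1 = p + (q - 1) by ring, rpow_add hx,
      rpow_neg hx.le]
    have : x ^ p ≠ 0 := (rpow_pos_of_pos hx p).ne'
    field_simp
  have h_right : ∀ s ∈ Set.Ioi (0 : ℝ),
      ∫ x in Set.Ioi (0 : ℝ), f s x = Gamma (p + q) * (s ^ (p - 1) * (1 + s) ^ (-(p + q))) := by
    intro s hs
    have hs : 0 < 1 + s := by have : 0 < s := hs; positivity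
    simp only [f]
    rw [integral_const_mul, integral_rpow_mul_exp_neg_mul_Ioi hpq hs, one_div,
      inv_rpow hs.le, ← rpow_neg hs.le]
    ring
  have h_nonneg : ∀ s ∈ Set.Ioi (0 : ℝ), ∀ x ∈ Set.Ioi (0 : ℝ), 0 ≤ f s x := by
    intro s hs x hx
    have : 0 < s := hs
    have : 0 < x := hx
    positivity
  have h_int : Integrable (Function.uncurry f)
      ((volume.restrict (Set.Ioi (0 : ℝ))).prod (volume.restrict (Set.Ioi (0 : ℝ)))) := by
    have hm : Measurable (Function.uncurry f) := by
      simp only [f, Function.uncurry_def]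
      fun_prop
    refine (integrable_prod_iff' hm.aestronglyMeasurable).2 ⟨?_, ?_⟩
    · filter_upwards [ae_restrict_mem measurableSet_Ioi] with x hx
      refine Integrable.of_integral_ne_zero ?_
      simp only [Function.uncurry_apply_pair]
      rw [h_left x hx]
      have : 0 < x := hx
      have := Gamma_pos_of_pos hp
      positivity
    · refine ((GammaIntegral_convergent hq).const_mul (Gamma p)).congr ?_
      filter_upwards [ae_restrict_mem measurableSet_Ioi] with x hx
      rw [← h_left x hx]
      refine setIntegral_congr_fun measurableSet_Ioi fun s hs => ?_
      exact (Real.norm_of_nonneg (h_nonneg s hs x hx)).symm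
  have h_swap := integral_integral_swap h_int
  rw [setIntegral_congr_fun measurableSet_Ioi h_right,
    setIntegral_congr_fun measurableSet_Ioi h_left, integral_const_mul, integral_const_mul,
    ← Gamma_eq_integral hq] at h_swap
  rw [eq_div_iff (Gamma_pos_of_pos hpq).ne', ← h_swap, mul_comm]

/-- Integration of a function of `|y|²` over `ℝ^β`. -/
lemma integral_comp_sum_sq {β : ℕ} (hβ : 0 < β) (f : ℝ → ℝ) :
    ∫ y : Fin β → ℝ, f (∑ s, y s ^ 2) =
      π ^ ((β : ℝ) / 2) / Gamma ((β : ℝ) / 2) *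
        ∫ s in Set.Ioi (0 : ℝ), s ^ ((β : ℝ) / 2 - 1) * f s := by
  have : Nonempty (Fin β) := ⟨⟨0, hβ⟩⟩
  have : Nontrivial (EuclideanSpace ℝ (Fin β)) :=
    Module.nontrivial_of_finrank_pos (R := ℝ) (by simpa using hβ)
  have hβ' : (0 : ℝ) < (β : ℝ) / 2 := by positivity
  have hΓ : 0 < Gamma ((β : ℝ) / 2 + 1) := Gamma_pos_of_pos (by positivity)
  have h_toLp : ∫ y : Fin β → ℝ, f (∑ s, y s ^ 2) =
      ∫ x : EuclideanSpace ℝ (Fin β), f (‖x‖ ^ 2) := by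
    rw [← (PiLp.volume_preserving_ofLp (Fin β)).integral_comp
      (MeasurableEquiv.toLp 2 (Fin β → ℝ)).symm.measurableEmbedding]
    simp [EuclideanSpace.norm_sq_eq]
  have h_sq : ∫ y in Set.Ioi (0 : ℝ), y ^ (β - 1) • f (y ^ 2) =
      2⁻¹ * ∫ s in Set.Ioi (0 : ℝ), s ^ ((β : ℝ) / 2 - 1) * f s := by
    rw [← integral_comp_rpow_Ioi_of_pos (g := fun s => s ^ ((β : ℝ) / 2 - 1) * f s) two_pos,
      ← integral_const_mul]
    refine setIntegral_congr_fun measurableSet_Ioi fun y hy => ?_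
    have hy : 0 < y := hy
    simp only [smul_eq_mul]
    rw [← rpow_mul hy.le, ← rpow_natCast y (β - 1), Nat.cast_sub hβ, rpow_two,
      show ((β : ℝ) - (1 : ℕ)) = (2 - 1) + 2 * ((β : ℝ) / 2 - 1) by push_cast; ring, rpow_add hy]
    ring
  rw [h_toLp, integral_fun_norm_addHaar volume (fun y => f (y ^ 2)), measureReal_def,
    EuclideanSpace.volume_ball, finrank_euclideanSpace, Fintype.card_fin, h_sq, ENNReal.ofReal_one,
    one_pow, one_mul, ENNReal.toReal_ofReal (by positivity), Gamma_add_one hβ'.ne',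
    sqrt_eq_rpow, ← rpow_natCast, ← rpow_mul pi_pos.le, show 1 / 2 * (β : ℝ) = β / 2 by ring]
  have := (Gamma_pos_of_pos hβ').ne'
  have : (β : ℝ) ≠ 0 := by positivity
  simp only [nsmul_eq_mul, smul_eq_mul]
  field_simp

/-- The integrand of Frullani's integral for `exp (-t)` is absolutely integrable. -/
lemma integrableOn_exp_neg_sub_exp_neg_mul_div {r : ℝ} (hr : 0 < r) :
    IntegrableOn (fun t => (exp (-t) - exp (-t * r)) / t) (Set.Ioi 0) := by
  have hm : 0 < min 1 r := lt_min one_pos hr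
  refine Integrable.mono' ((exp_neg_integrableOn_Ioi 0 hm).const_mul |r - 1|) ?_ ?_
  · exact Measurable.aestronglyMeasurable (by fun_prop)
  · filter_upwards [ae_restrict_mem measurableSet_Ioi] with t ht
    have ht : 0 < t := ht
    have key : ∀ {u v : ℝ}, u ≤ v → |exp (-t * u) - exp (-t * v)| ≤ t * |v - u| * exp (-u * t) := by
      intro u v huv
      rw [abs_of_nonneg (sub_nonneg.2 (exp_le_exp.2 (by nlinarith))),
        abs_of_nonneg (sub_nonneg.2 huv),
        show -t * v = -t * u + -(t * (v - u)) by ring, exp_add, neg_mul_comm t u, mul_comm t (-u)]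
      have := one_sub_le_exp_neg (t * (v - u))
      nlinarith [exp_pos (-u * t)]
    rw [norm_div, Real.norm_eq_abs, Real.norm_eq_abs, abs_of_pos ht, div_le_iff₀ ht]
    rcases le_total 1 r with h | h
    · have := key h
      rw [mul_one] at this
      rw [min_eq_left h]
      linarith
    · have := key h
      rw [mul_one, abs_sub_comm, abs_sub_comm 1 r] at this
      rw [min_eq_right h]
      linarith

/-- Frullani's integral for the logarithm. -/
lemma integral_exp_neg_sub_exp_neg_mul_div {r : ℝ} (hr : 0 < r) :
    ∫ t in Set.Ioi (0 : ℝ), (exp (-t) - exp (-t * r)) / t = log r := by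
  have hc : Continuous fun t : ℝ => exp (-t) := by fun_prop
  have h := Frullani.integral_Ioi_eq (f := fun t : ℝ => exp (-t)) (a := 1) (b := r) (L := 1) (R := 0)
    (hc.locallyIntegrable.locallyIntegrableOn _) one_pos hr
    ((by simpa using hc.tendsto 0 : Filter.Tendsto (fun t : ℝ => exp (-t)) (nhds 0) (nhds 1)).mono_left
      nhdsWithin_le_nhds) tendsto_exp_neg_atTop_nhds_zero
    ((integrableOn_exp_neg_sub_exp_neg_mul_div hr).congr_fun
      (fun t _ => by simp [div_eq_inv_mul, mul_comm]) measurableSet_Ioi)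
  simpa [div_eq_inv_mul, mul_comm] using h

/-- Frullani's integral for the absolute value of the logarithm. -/
lemma integral_abs_exp_neg_sub_exp_neg_mul_div {r : ℝ} (hr : 0 < r) :
    ∫ t in Set.Ioi (0 : ℝ), |(exp (-t) - exp (-t * r)) / t| = |log r| := by
  rcases le_total 1 r with h | h
  · rw [abs_of_nonneg (log_nonneg h), ← integral_exp_neg_sub_exp_neg_mul_div hr]
    refine setIntegral_congr_fun measurableSet_Ioi fun t ht => abs_of_nonneg ?_
    have ht : 0 < t := ht
    exact div_nonneg (sub_nonneg.2 (exp_le_exp.2 (by nlinarith))) ht.le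
  · rw [abs_of_nonpos (log_nonpos hr.le h), ← integral_exp_neg_sub_exp_neg_mul_div hr,
      ← integral_neg]
    refine setIntegral_congr_fun measurableSet_Ioi fun t ht => abs_of_nonpos ?_
    have ht : 0 < t := ht
    exact div_nonpos_of_nonpos_of_nonneg (sub_nonpos.2 (exp_le_exp.2 (by nlinarith))) ht.le

lemma measurable_betaIIVecDensity (β : ℕ) (ω : ℝ) : Measurable fun y : Fin β → ℝ =>
    ENNReal.ofReal ((Gamma ((ω + (β : ℝ)) / 2) / (π ^ ((β : ℝ) / 2) * Gamma (ω / 2))) *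
      (1 + ∑ s, y s ^ 2) ^ (-(ω + (β : ℝ)) / 2)) := by
  fun_prop

/-- Law of `|y|²` under the beta type II distribution on `ℝ^β`. -/
lemma integral_comp_sum_sq_betaIIVecMeasure {β : ℕ} (hβ : 0 < β) {ω : ℝ} (hω : 0 < ω)
    (f : ℝ → ℝ) :
    ∫ y, f (∑ s, y s ^ 2) ∂(betaIIVecMeasure β ω) =
      Gamma ((ω + (β : ℝ)) / 2) / (Gamma ((β : ℝ) / 2) * Gamma (ω / 2)) *
        ∫ s in Set.Ioi (0 : ℝ), s ^ ((β : ℝ) / 2 - 1) * ((1 + s) ^ (-(ω + (β : ℝ)) / 2) * f s) := by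
  have h₁ : 0 < Gamma ((ω + (β : ℝ)) / 2) := Gamma_pos_of_pos (by positivity)
  have h₂ : 0 < Gamma (ω / 2) := Gamma_pos_of_pos (by positivity)
  have h₃ : 0 < Gamma ((β : ℝ) / 2) := Gamma_pos_of_pos (by positivity)
  have h₄ : 0 < π ^ ((β : ℝ) / 2) := rpow_pos_of_pos pi_pos _
  rw [betaIIVecMeasure, integral_withDensity_eq_integral_toReal_smul
    (measurable_betaIIVecDensity β ω) (ae_of_all _ fun _ => ENNReal.ofReal_lt_top)]
  have h : ∀ y : Fin β → ℝ,
      (ENNReal.ofReal ((Gamma ((ω + (β : ℝ)) / 2) / (π ^ ((β : ℝ) / 2) * Gamma (ω / 2))) *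
        (1 + ∑ s, y s ^ 2) ^ (-(ω + (β : ℝ)) / 2))).toReal • f (∑ s, y s ^ 2) =
      (Gamma ((ω + (β : ℝ)) / 2) / (π ^ ((β : ℝ) / 2) * Gamma (ω / 2))) *
        ((1 + ∑ s, y s ^ 2) ^ (-(ω + (β : ℝ)) / 2) * f (∑ s, y s ^ 2)) := fun y => by
    rw [ENNReal.toReal_ofReal (by positivity), smul_eq_mul, mul_assoc]
  simp_rw [h]
  rw [integral_const_mul,
    integral_comp_sum_sq hβ (fun r => (1 + r) ^ (-(ω + (β : ℝ)) / 2) * f r), ← mul_assoc]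
  congr 1
  field_simp

lemma isProbabilityMeasure_betaIIVecMeasure {β : ℕ} (hβ : 0 < β) {ω : ℝ} (hω : 0 < ω) :
    IsProbabilityMeasure (betaIIVecMeasure β ω) := by
  have hβ' : (0 : ℝ) < (β : ℝ) / 2 := by positivity
  have hω' : 0 < ω / 2 := by positivity
  have h := integral_comp_sum_sq_betaIIVecMeasure hβ hω fun _ => 1
  have hB := integral_rpow_mul_one_add_rpow_neg hβ' hω'
  rw [show -((β : ℝ) / 2 + ω / 2) = -(ω + β) / 2 by ring,
    show (β : ℝ) / 2 + ω / 2 = (ω + β) / 2 by ring] at hB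
  simp only [mul_one, hB, integral_const, smul_eq_mul] at h
  have h₁ := (Gamma_pos_of_pos (show 0 < (ω + (β : ℝ)) / 2 by positivity)).ne'
  have h₂ := (Gamma_pos_of_pos hω').ne'
  have h₃ := (Gamma_pos_of_pos hβ').ne'
  field_simp at h
  exact ⟨(ENNReal.toReal_eq_one_iff _).1 h⟩

/-- Laplace transform of `|y|²` under the beta type II distribution on `ℝ^β`. -/
lemma integral_exp_neg_mul_sum_sq_betaIIVecMeasure {β : ℕ} (hβ : 0 < β) {ω : ℝ} (hω : 0 < ω)
    (t : ℝ) :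
    ∫ y, exp (-t * ∑ s, y s ^ 2) ∂(betaIIVecMeasure β ω) =
      Gamma ((ω + (β : ℝ)) / 2) / Gamma (ω / 2) * hypU ((β : ℝ) / 2) (1 - ω / 2) t := by
  rw [integral_comp_sum_sq_betaIIVecMeasure hβ hω fun r => exp (-t * r), hypU,
    show 1 - ω / 2 - (β : ℝ) / 2 - 1 = -(ω + β) / 2 by ring, ← mul_assoc]
  congr 1
  · rw [mul_comm (Gamma ((β : ℝ) / 2)), ← div_div, mul_one_div]
  · exact integral_congr_ae (ae_of_all _ fun s => by ring)

lemma ae_sum_sq_pos_betaIIVecMeasure {β : ℕ} (hβ : 0 < β) (ω : ℝ) :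
    ∀ᵐ y ∂(betaIIVecMeasure β ω), 0 < ∑ s, y s ^ 2 := by
  have : Nonempty (Fin β) := ⟨⟨0, hβ⟩⟩
  refine (withDensity_absolutelyContinuous _ _).ae_le ?_
  filter_upwards [Measure.ae_ne volume (0 : Fin β → ℝ)] with y hy
  obtain ⟨s, hs⟩ := Function.ne_iff.1 hy
  exact Finset.sum_pos' (fun _ _ => sq_nonneg _) ⟨s, Finset.mem_univ s, sq_pos_of_ne_zero hs⟩

/-- Moments `E[|y|^{2 a} (1 + |y|²)^b]` exist when `-β/2 < a` and `a + b < ω/2`. -/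
lemma integrable_sum_sq_rpow_mul_betaIIVecMeasure {β : ℕ} (hβ : 0 < β) {ω : ℝ} (hω : 0 < ω)
    {a b : ℝ} (ha : 0 < (β : ℝ) / 2 + a) (hb : 0 < ω / 2 - a - b) :
    Integrable (fun y : Fin β → ℝ => (∑ s, y s ^ 2) ^ a * (1 + ∑ s, y s ^ 2) ^ b)
      (betaIIVecMeasure β ω) := by
  refine Integrable.of_integral_ne_zero ?_
  rw [integral_comp_sum_sq_betaIIVecMeasure hβ hω fun r => r ^ a * (1 + r) ^ b]
  have h : ∀ s ∈ Set.Ioi (0 : ℝ),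
      s ^ ((β : ℝ) / 2 - 1) * ((1 + s) ^ (-(ω + (β : ℝ)) / 2) * (s ^ a * (1 + s) ^ b)) =
      s ^ ((β : ℝ) / 2 + a - 1) * (1 + s) ^ (-((β : ℝ) / 2 + a + (ω / 2 - a - b))) := by
    intro s hs
    have hs : 0 < s := hs
    rw [show (β : ℝ) / 2 + a - 1 = ((β : ℝ) / 2 - 1) + a by ring, rpow_add hs,
      show -((β : ℝ) / 2 + a + (ω / 2 - a - b)) = -(ω + (β : ℝ)) / 2 + b by ring,
      rpow_add (by positivity)]
    ring
  rw [setIntegral_congr_fun measurableSet_Ioi h, integral_rpow_mul_one_add_rpow_neg ha hb]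
  have h₁ := Gamma_pos_of_pos (show 0 < (ω + (β : ℝ)) / 2 by positivity)
  have h₂ := Gamma_pos_of_pos (show 0 < ω / 2 by positivity)
  have h₃ := Gamma_pos_of_pos (show 0 < (β : ℝ) / 2 by positivity)
  have h₄ := Gamma_pos_of_pos ha
  have h₅ := Gamma_pos_of_pos hb
  have h₆ := Gamma_pos_of_pos (add_pos ha hb)
  positivity

lemma integrable_log_one_add_sum_sq_betaIIVecMeasure {β : ℕ} (hβ : 0 < β) {ω : ℝ} (hω : 0 < ω) :
    Integrable (fun y : Fin β → ℝ => log (1 + ∑ s, y s ^ 2)) (betaIIVecMeasure β ω) := by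
  have h := integrable_sum_sq_rpow_mul_betaIIVecMeasure hβ hω (a := 0) (b := ω / 4)
    (by positivity) (by linarith)
  refine (h.div_const (ω / 4)).mono' (Measurable.aestronglyMeasurable (by fun_prop))
    (ae_of_all _ fun y => ?_)
  have hr : 0 ≤ ∑ s, y s ^ 2 := by positivity
  rw [Real.norm_of_nonneg (log_nonneg (by linarith)), rpow_zero, one_mul]
  exact log_le_rpow_div (by positivity) (by positivity)

lemma integrable_log_sum_sq_betaIIVecMeasure {β : ℕ} (hβ : 0 < β) {ω : ℝ} (hω : 0 < ω) :
    Integrable (fun y : Fin β → ℝ => log (∑ s, y s ^ 2)) (betaIIVecMeasure β ω) := by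
  have hβ' : (1 : ℝ) ≤ β := by exact_mod_cast hβ
  have h := integrable_sum_sq_rpow_mul_betaIIVecMeasure hβ hω (a := -(1 / 4)) (b := 0)
    (by linarith) (by linarith)
  refine ((integrable_log_one_add_sum_sq_betaIIVecMeasure hβ hω).add
    (h.div_const (1 / 4))).mono' (Measurable.aestronglyMeasurable (by fun_prop)) ?_
  filter_upwards [ae_sum_sq_pos_betaIIVecMeasure hβ ω] with y hy
  have h₁ : log (∑ s, y s ^ 2) ≤ log (1 + ∑ s, y s ^ 2) := log_le_log hy (by linarith)
  have h₂ : 0 ≤ log (1 + ∑ s, y s ^ 2) := log_nonneg (by linarith)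
  have h₃ := log_le_rpow_div (inv_nonneg.2 hy.le) (show (0 : ℝ) < 1 / 4 by norm_num)
  rw [log_inv, inv_rpow hy.le, ← rpow_neg hy.le] at h₃
  have h₄ : 0 < (∑ s, y s ^ 2) ^ (-(1 / 4 : ℝ)) / (1 / 4) := by positivity
  simp only [Pi.add_apply, rpow_zero, mul_one]
  exact abs_le.2 ⟨by linarith, by linarith⟩

lemma one_add_sum_le_prod_one_add {ι : Type*} (s : Finset ι) {r : ι → ℝ} (hr : ∀ i, 0 ≤ r i) :
    1 + ∑ i ∈ s, r i ≤ ∏ i ∈ s, (1 + r i) := by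
  classical
  induction s using Finset.induction_on with
  | empty => simp
  | insert i s hi ih =>
    rw [Finset.sum_insert hi, Finset.prod_insert hi]
    have : 0 ≤ ∑ i ∈ s, r i := Finset.sum_nonneg fun i _ => hr i
    nlinarith [hr i]

lemma abs_log_sum_le {ι : Type*} [Fintype ι] {r : ι → ℝ} (hr : ∀ i, 0 ≤ r i) {j : ι}
    (hj : 0 < r j) : |log (∑ i, r i)| ≤ |log (r j)| + ∑ i, log (1 + r i) := by
  have hle : r j ≤ ∑ i, r i := Finset.single_le_sum (fun i _ => hr i) (Finset.mem_univ j)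
  have h₁ : log (r j) ≤ log (∑ i, r i) := log_le_log hj hle
  have h₂ : log (∑ i, r i) ≤ ∑ i, log (1 + r i) := by
    rw [← log_prod fun i _ => by have := hr i; positivity]
    refine log_le_log (hj.trans_le hle) ?_
    have := one_add_sum_le_prod_one_add Finset.univ hr
    linarith
  have h₃ : 0 ≤ ∑ i, log (1 + r i) :=
    Finset.sum_nonneg fun i _ => log_nonneg (by have := hr i; linarith)
  have h₄ := neg_abs_le (log (r j))
  exact abs_le.2 ⟨by linarith, by linarith [abs_nonneg (log (r j))]⟩

/-- The expectation of the logarithm of a positive random variable in terms of its Laplace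
transform. -/
lemma integral_log_eq_integral_exp_neg_sub_laplace {Ω : Type*} [MeasurableSpace Ω]
    {μ : Measure Ω} [IsProbabilityMeasure μ] {R : Ω → ℝ} (hR : Measurable R)
    (h_pos : ∀ᵐ y ∂μ, 0 < R y) (h_log : Integrable (fun y => log (R y)) μ) :
    ∫ y, log (R y) ∂μ =
      ∫ t in Set.Ioi (0 : ℝ), (exp (-t) - ∫ y, exp (-t * R y) ∂μ) / t := by
  let f : Ω → ℝ → ℝ := fun y t => (exp (-t) - exp (-t * R y)) / t
  have h_int : Integrable (Function.uncurry f) (μ.prod (volume.restrict (Set.Ioi (0 : ℝ)))) := by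
    have hm : Measurable (Function.uncurry f) := by
      simp only [f, Function.uncurry_def]
      fun_prop
    refine (integrable_prod_iff hm.aestronglyMeasurable).2 ⟨?_, ?_⟩
    · filter_upwards [h_pos] with y hy
      exact integrableOn_exp_neg_sub_exp_neg_mul_div hy
    · refine h_log.abs.congr ?_
      filter_upwards [h_pos] with y hy
      exact (integral_abs_exp_neg_sub_exp_neg_mul_div hy).symm
  calc ∫ y, log (R y) ∂μ
      = ∫ y, (∫ t in Set.Ioi (0 : ℝ), f y t) ∂μ := by
        refine integral_congr_ae ?_
        filter_upwards [h_pos] with y hy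
        exact (integral_exp_neg_sub_exp_neg_mul_div hy).symm
    _ = ∫ t in Set.Ioi (0 : ℝ), ∫ y, f y t ∂μ := integral_integral_swap h_int
    _ = _ := by
        refine setIntegral_congr_fun measurableSet_Ioi fun t ht => ?_
        have ht : 0 < t := ht
        have h_exp : Integrable (fun y => exp (-t * R y)) μ := by
          refine Integrable.of_bound (Measurable.aestronglyMeasurable (by fun_prop)) 1 ?_
          filter_upwards [h_pos] with y hy
          rw [Real.norm_of_nonneg (exp_pos _).le, exp_le_one_iff]
          nlinarith
        simp only [f]
        rw [integral_div, integral_sub (integrable_const _) h_exp]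
        simp

theorem statement19 (β N : ℕ) (hβ : 0 < β) (hN : 0 < N)
    (ω : Fin N → ℝ) (hω : ∀ l, 0 < ω l) :
    Integrable (fun y : Fin N → Fin β → ℝ => Real.log (∑ l, ∑ s, y l s ^ 2))
      (Measure.pi fun l => betaIIVecMeasure β (ω l)) ∧
    ∫ y : Fin N → Fin β → ℝ, Real.log (∑ l, ∑ s, y l s ^ 2)
        ∂(Measure.pi fun l => betaIIVecMeasure β (ω l)) =
      ∫ t in Set.Ioi (0 : ℝ),
        (Real.exp (-t) -
          ∏ l, (Real.Gamma ((ω l + (β : ℝ)) / 2) / Real.Gamma (ω l / 2)) *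
            hypU ((β : ℝ) / 2) (1 - ω l / 2) t) / t := by
  have hprob : ∀ l, IsProbabilityMeasure (betaIIVecMeasure β (ω l)) := fun l =>
    isProbabilityMeasure_betaIIVecMeasure hβ (hω l)
  set μ := Measure.pi fun l => betaIIVecMeasure β (ω l) with hμ
  let l₀ : Fin N := ⟨0, hN⟩
  have h_pos₀ : ∀ᵐ y ∂μ, 0 < ∑ s, y l₀ s ^ 2 :=
    (measurePreserving_eval (fun l => betaIIVecMeasure β (ω l)) l₀).quasiMeasurePreserving.ae
      (ae_sum_sq_pos_betaIIVecMeasure hβ (ω l₀))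
  have h_pos : ∀ᵐ y ∂μ, 0 < ∑ l, ∑ s, y l s ^ 2 := by
    filter_upwards [h_pos₀] with y hy
    exact Finset.sum_pos' (fun _ _ => by positivity) ⟨l₀, Finset.mem_univ _, hy⟩
  have h_log : Integrable (fun y : Fin N → Fin β → ℝ => log (∑ l, ∑ s, y l s ^ 2)) μ := by
    have h₀ := (integrable_comp_eval (μ := fun l => betaIIVecMeasure β (ω l))
      (integrable_log_sum_sq_betaIIVecMeasure hβ (hω l₀))).abs
    have h₁ := integrable_finsetSum Finset.univ fun l _ =>
      integrable_comp_eval (μ := fun l => betaIIVecMeasure β (ω l))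
        (integrable_log_one_add_sum_sq_betaIIVecMeasure hβ (hω l))
    refine (h₀.add h₁).mono' (Measurable.aestronglyMeasurable (by fun_prop)) ?_
    filter_upwards [h_pos₀] with y hy
    exact abs_log_sum_le (r := fun l => ∑ s, y l s ^ 2) (fun _ => by positivity) hy
  refine ⟨h_log, ?_⟩
  have h_exp (t : ℝ) : ∫ y : Fin N → Fin β → ℝ, exp (-t * ∑ l, ∑ s, y l s ^ 2) ∂μ =
      ∏ l, (Gamma ((ω l + (β : ℝ)) / 2) / Gamma (ω l / 2)) *
        hypU ((β : ℝ) / 2) (1 - ω l / 2) t := by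
    simp_rw [Finset.mul_sum Finset.univ (fun l => ∑ s, _ ^ 2), exp_sum, hμ]
    rw [integral_fintype_prod_eq_prod (fun _ (y : Fin β → ℝ) => exp (-t * ∑ s, y s ^ 2))]
    exact Finset.prod_congr rfl fun l _ =>
      integral_exp_neg_mul_sum_sq_betaIIVecMeasure hβ (hω l) t
  rw [integral_log_eq_integral_exp_neg_sub_laplace (by fun_prop) h_pos h_log]
  simp_rw [h_exp]
end
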